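/- arXiv:1411.2546 — 2 statements merged into one kernel-verified Lean document; each statement's English description precedes it below -/
import Mathlib

section
/- The fundamental group of V = (I × {0}³) ∪ ⋃_{n≥1} gₙ, based at the origin, is a free group with basis the homotopy classes of the loops traversing each triangle boundary gₙ (going out along the segment from 0 to (1, 1/n, 0, 0), down to (1, 1/(n+1/2), 0, 0), and back). -/
open Set

/-- The point `(a, b, 0, 0)` in `ℝ⁴`. -/
noncomputable def pt (a b : ℝ) : Fin 4 → ℝ := ![a, b, 0, 0]

/-- The boundary `gₙ` of the triangle in `I² × {0}² ⊂ ℝ⁴` with vertices `(0,0,0,0)`,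
`(1, 1/n, 0, 0)` and `(1, 1/(n + 1/2), 0, 0)`: the union of its three edges. -/
noncomputable def tri (n : ℕ) : Set (Fin 4 → ℝ) :=
  segment ℝ (pt 0 0) (pt 1 (1 / (n : ℝ))) ∪
    segment ℝ (pt 0 0) (pt 1 (1 / ((n : ℝ) + 1 / 2))) ∪
    segment ℝ (pt 1 (1 / (n : ℝ))) (pt 1 (1 / ((n : ℝ) + 1 / 2)))

/-- The segment `I × {0}³ ⊂ ℝ⁴`. -/
noncomputable def seg : Set (Fin 4 → ℝ) := (fun x : ℝ => pt x 0) '' Icc 0 1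

/-- `V = (I × {0}³) ∪ ⋃_{n ≥ 1} gₙ`. -/
noncomputable def V : Set (Fin 4 → ℝ) := seg ∪ ⋃ n ∈ {n : ℕ | 1 ≤ n}, tri n

attribute [local instance] Path.Homotopic.setoid

open Topology Filter CategoryTheory
lemma pt_smul_add (a b u v : ℝ) (s t : ℝ) : s • pt a b + t • pt u v = pt (s*a+t*u) (s*b+t*v) := by
  ext i; fin_cases i <;> simp [pt]

lemma eq_pt (v : Fin 4 → ℝ) (h2 : v 2 = 0) (h3 : v 3 = 0) : v = pt (v 0) (v 1) := by
  ext i; fin_cases i <;> simp [pt, h2, h3]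

@[simp] lemma pt0 (a b : ℝ) : pt a b 0 = a := rfl
@[simp] lemma pt1 (a b : ℝ) : pt a b 1 = b := rfl
@[simp] lemma pt2 (a b : ℝ) : pt a b 2 = 0 := rfl
@[simp] lemma pt3 (a b : ℝ) : pt a b 3 = 0 := rfl

/-- planar unit strip -/
def Pl (v : Fin 4 → ℝ) : Prop := v 2 = 0 ∧ v 3 = 0 ∧ 0 ≤ v 0 ∧ v 0 ≤ 1

lemma mem_ray (c : ℝ) (hc : 0 < c) (v : Fin 4 → ℝ) :
    v ∈ segment ℝ (pt 0 0) (pt 1 (1 / c)) ↔ Pl v ∧ v 1 * c = v 0 := by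
  constructor
  · rintro ⟨s, t, hs, ht, hst, rfl⟩
    rw [pt_smul_add]
    refine ⟨⟨by simp, by simp, by simpa using ht, by simp; linarith⟩, ?_⟩
    simp; field_simp
  · rintro ⟨⟨h2, h3, h0, h1⟩, h⟩
    refine ⟨1 - v 0, v 0, by linarith, h0, by ring, ?_⟩
    rw [pt_smul_add, eq_pt v h2 h3]
    congr 1
    · simp
    · simp; rw [← h]; field_simp

lemma mem_vert (n : ℕ) (hn : 1 ≤ n) (v : Fin 4 → ℝ) :
    v ∈ segment ℝ (pt 1 (1 / (n : ℝ))) (pt 1 (1 / ((n : ℝ) + 1 / 2))) ↔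
      Pl v ∧ v 0 = 1 ∧ v 1 * n ≤ 1 ∧ 1 ≤ v 1 * (n + 1/2) := by
  have hn' : (1:ℝ) ≤ n := by exact_mod_cast hn
  constructor
  · rintro ⟨s, t, hs, ht, hst, rfl⟩
    obtain rfl : s = 1 - t := by linarith
    rw [pt_smul_add]
    refine ⟨⟨by simp, by simp, by simp, by simp⟩, by simp, ?_, ?_⟩
    · simp only [pt1]
      have : ((1 - t) * (1 / (n:ℝ)) + t * (1 / ((n:ℝ) + 1 / 2))) * n = 1 - t * (1/2) / (n + 1/2) := by
        field_simp; ring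
      rw [this]
      have : 0 ≤ t * (1/2) / ((n:ℝ) + 1/2) := by positivity
      linarith
    · simp only [pt1]
      have : ((1 - t) * (1 / (n:ℝ)) + t * (1 / ((n:ℝ) + 1 / 2))) * (n+1/2) = 1 + (1-t) * (1/2) / n := by
        field_simp; ring
      rw [this]
      have : 0 ≤ (1-t) * (1/2) / (n:ℝ) := by positivity
      linarith
  · rintro ⟨⟨h2, h3, -, -⟩, h, ha, hb⟩
    refine ⟨2 * n * (v 1 * (n + 1/2) - 1), 2 * (n + 1/2) * (1 - v 1 * n), ?_, ?_, by ring, ?_⟩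
    · have : 0 ≤ v 1 * (n + 1/2) - 1 := by linarith
      positivity
    · have : 0 ≤ 1 - v 1 * n := by linarith
      positivity
    · rw [pt_smul_add, eq_pt v h2 h3]
      congr 1
      · rw [h]; ring
      · simp only [pt1]; field_simp; ring

def E1 (n : ℕ) : Set (Fin 4 → ℝ) := {v | Pl v ∧ v 1 * n = v 0}
def E2 (n : ℕ) : Set (Fin 4 → ℝ) := {v | Pl v ∧ v 1 * (n + 1/2) = v 0}
def E3 (n : ℕ) : Set (Fin 4 → ℝ) := {v | Pl v ∧ v 0 = 1 ∧ v 1 * n ≤ 1 ∧ 1 ≤ v 1 * (n + 1/2)}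
def SG : Set (Fin 4 → ℝ) := {v | Pl v ∧ v 1 = 0}

lemma E1_eq (n : ℕ) (hn : 1 ≤ n) : segment ℝ (pt 0 0) (pt 1 (1 / (n : ℝ))) = E1 n := by
  ext v; exact mem_ray n (by exact_mod_cast hn) v
lemma E2_eq (n : ℕ) : segment ℝ (pt 0 0) (pt 1 (1 / ((n : ℝ) + 1/2))) = E2 n := by
  ext v; exact mem_ray _ (by positivity) v
lemma E3_eq (n : ℕ) (hn : 1 ≤ n) :
    segment ℝ (pt 1 (1 / (n : ℝ))) (pt 1 (1 / ((n : ℝ) + 1 / 2))) = E3 n := by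
  ext v; exact mem_vert n hn v
lemma tri_eq (n : ℕ) (hn : 1 ≤ n) : tri n = E1 n ∪ E2 n ∪ E3 n := by
  rw [tri, E1_eq n hn, E2_eq n, E3_eq n hn]

lemma mem_V (v : Fin 4 → ℝ) : v ∈ V ↔ v ∈ SG ∨ ∃ n : ℕ, 1 ≤ n ∧ (v ∈ E1 n ∨ v ∈ E2 n ∨ v ∈ E3 n) := by
  have hs : seg = SG := by
    ext v; constructor
    · rintro ⟨x, hx, rfl⟩
      exact ⟨⟨rfl, rfl, hx.1, hx.2⟩, rfl⟩
    · rintro ⟨⟨h2, h3, h⟩, h1⟩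
      exact ⟨v 0, h, by rw [eq_pt v h2 h3, h1]; rfl⟩
  rw [V, hs, mem_union]
  simp only [mem_iUnion, mem_ofPred_eq, exists_prop]
  refine or_congr Iff.rfl (exists_congr fun n => and_congr_right fun hn => ?_)
  rw [tri_eq n hn]; simp only [mem_union]; tauto

lemma V_pl {v : Fin 4 → ℝ} (h : v ∈ V) : Pl v := by
  rcases (mem_V v).1 h with h | ⟨n, -, h | h | h⟩ <;> exact h.1

def U1 : Set (Fin 4 → ℝ) := {v | v ∈ V ∧ v 0 < 1}
def A (n : ℕ) : Set (Fin 4 → ℝ) := E1 n ∪ E3 n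
def B (n : ℕ) : Set (Fin 4 → ℝ) := E2 n ∪ E3 n

lemma E1_sub {n : ℕ} (hn : 1 ≤ n) : E1 n ⊆ V := fun v h => (mem_V v).2 (.inr ⟨n, hn, .inl h⟩)
lemma E2_sub {n : ℕ} (hn : 1 ≤ n) : E2 n ⊆ V := fun v h => (mem_V v).2 (.inr ⟨n, hn, .inr (.inl h)⟩)
lemma E3_sub {n : ℕ} (hn : 1 ≤ n) : E3 n ⊆ V := fun v h => (mem_V v).2 (.inr ⟨n, hn, .inr (.inr h)⟩)
lemma SG_sub : SG ⊆ V := fun v h => (mem_V v).2 (.inl h)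
lemma U1_sub : U1 ⊆ V := fun v h => h.1
lemma A_sub {n : ℕ} (hn : 1 ≤ n) : A n ⊆ V := union_subset (E1_sub hn) (E3_sub hn)
lemma B_sub {n : ℕ} (hn : 1 ≤ n) : B n ⊆ V := union_subset (E2_sub hn) (E3_sub hn)

lemma SG_convex : Convex ℝ SG := by
  rintro v ⟨⟨h2, h3, h0, h1⟩, h⟩ w ⟨⟨k2, k3, k0, k1⟩, k⟩ a b ha hb hab
  refine ⟨⟨by simp [*], by simp [*], ?_, ?_⟩, by simp [*]⟩
  · simp; positivity
  · simp; nlinarith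

lemma E1_convex {n : ℕ} (hn : 1 ≤ n) : Convex ℝ (E1 n) := by
  rw [← E1_eq n hn]; exact convex_segment _ _
lemma E2_convex (n : ℕ) : Convex ℝ (E2 n) := by
  rw [← E2_eq n]; exact convex_segment _ _
lemma E3_convex {n : ℕ} (hn : 1 ≤ n) : Convex ℝ (E3 n) := by
  rw [← E3_eq n hn]; exact convex_segment _ _

noncomputable def c1 (n : ℕ) : Fin 4 → ℝ := pt 1 (1 / (n : ℝ))
noncomputable def c2 (n : ℕ) : Fin 4 → ℝ := pt 1 (1 / ((n : ℝ) + 1/2))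

lemma c1_E1 {n : ℕ} (hn : 1 ≤ n) : c1 n ∈ E1 n := by
  rw [← E1_eq n hn]; exact right_mem_segment _ _ _
lemma c1_E3 {n : ℕ} (hn : 1 ≤ n) : c1 n ∈ E3 n := by
  rw [← E3_eq n hn]; exact left_mem_segment _ _ _
lemma c2_E2 (n : ℕ) : c2 n ∈ E2 n := by
  rw [← E2_eq n]; exact right_mem_segment _ _ _
lemma c2_E3 {n : ℕ} (hn : 1 ≤ n) : c2 n ∈ E3 n := by
  rw [← E3_eq n hn]; exact right_mem_segment _ _ _
lemma o_E1 {n : ℕ} : pt 0 0 ∈ E1 n := by simp [E1, Pl]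
lemma o_E2 {n : ℕ} : pt 0 0 ∈ E2 n := by simp [E2, Pl]
lemma o_SG : pt 0 0 ∈ SG := by simp [SG, Pl]
lemma o_U1 : pt 0 0 ∈ U1 := ⟨SG_sub o_SG, by simp⟩

lemma star_union {S T : Set (Fin 4 → ℝ)} {c} (hS : Convex ℝ S) (hT : Convex ℝ T) (h : c ∈ S) (h' : c ∈ T) :
    StarConvex ℝ c (S ∪ T) := (hS.starConvex h).union (hT.starConvex h')

lemma A_star {n : ℕ} (hn : 1 ≤ n) : StarConvex ℝ (c1 n) (A n) :=
  star_union (E1_convex hn) (E3_convex hn) (c1_E1 hn) (c1_E3 hn)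
lemma B_star {n : ℕ} (hn : 1 ≤ n) : StarConvex ℝ (c2 n) (B n) :=
  star_union (E2_convex n) (E3_convex hn) (c2_E2 n) (c2_E3 hn)

lemma U1_ray {v : Fin 4 → ℝ} (h : v ∈ U1) : ∃ S ⊆ V, Convex ℝ S ∧ v ∈ S ∧ pt 0 0 ∈ S := by
  obtain ⟨hV, h1⟩ := h
  rcases (mem_V v).1 hV with h | ⟨n, hn, h | h | h⟩
  · exact ⟨SG, SG_sub, SG_convex, h, o_SG⟩
  · exact ⟨_, E1_sub hn, E1_convex hn, h, o_E1⟩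
  · exact ⟨_, E2_sub hn, E2_convex n, h, o_E2⟩
  · exact absurd h.2.1 h1.ne

lemma U1_star : StarConvex ℝ (pt 0 0) U1 := by
  intro v h a b ha hb hab
  obtain ⟨S, hS, hc, hv, ho⟩ := U1_ray h
  refine ⟨hS (hc ho hv ha hb hab), ?_⟩
  have := h.2
  have := (V_pl h.1).2.2.1
  simp
  nlinarith

lemma no34 {v : Fin 4 → ℝ} (h : v ∈ V) (n : ℕ) (hx : 0 < v 0) : v 0 ≠ v 1 * (n + 3/4) := by
  intro he
  have hy : 0 < v 1 := by
    by_contra hc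
    push Not at hc
    have : v 1 * (n + 3/4) ≤ 0 := mul_nonpos_of_nonpos_of_nonneg hc (by positivity)
    linarith
  rcases (mem_V v).1 h with h | ⟨m, hm, h | h | h⟩
  · exact hy.ne' h.2
  · have : (m:ℝ) = n + 3/4 := mul_left_cancel₀ hy.ne' (h.2.trans he)
    have : 4 * (m:ℝ) = 4 * n + 3 := by linarith
    norm_cast at this; omega
  · have : (m:ℝ) + 1/2 = n + 3/4 := mul_left_cancel₀ hy.ne' (h.2.trans he)
    have : 4 * (m:ℝ) + 2 = 4 * n + 3 := by linarith
    norm_cast at this; omega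
  · obtain ⟨-, h0, ha, hb⟩ := h
    rw [← h0, he] at ha hb
    have ha := le_of_mul_le_mul_left ha hy
    have hb := le_of_mul_le_mul_left hb hy
    have ha : 4 * (m:ℝ) ≤ 4 * n + 3 := by linarith
    have hb : 4 * (n:ℝ) + 3 ≤ 4 * m + 2 := by linarith
    norm_cast at ha hb; omega

lemma no14 {v : Fin 4 → ℝ} (h : v ∈ V) (n : ℕ) (hx : 0 < v 0) (he : v 0 = v 1 * (n + 1/4)) : v 0 = 1 := by
  have hy : 0 < v 1 := by
    by_contra hc
    push Not at hc
    have : v 1 * (n + 1/4) ≤ 0 := mul_nonpos_of_nonpos_of_nonneg hc (by positivity)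
    linarith
  rcases (mem_V v).1 h with h | ⟨m, hm, h | h | h⟩
  · exact absurd h.2 hy.ne'
  · have : (m:ℝ) = n + 1/4 := mul_left_cancel₀ hy.ne' (h.2.trans he)
    have : 4 * (m:ℝ) = 4 * n + 1 := by linarith
    norm_cast at this; omega
  · have : (m:ℝ) + 1/2 = n + 1/4 := mul_left_cancel₀ hy.ne' (h.2.trans he)
    have : 4 * (m:ℝ) + 2 = 4 * n + 1 := by linarith
    norm_cast at this; omega
  · exact h.2.1

lemma near_A {v : Fin 4 → ℝ} (h : v ∈ V) {n : ℕ} (hx : 0 < v 0) (ha : v 0 < v 1 * (n + 1/2))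
    (hb : v 1 * (n - 1/2) < v 0) : v ∈ A n := by
  have hy : 0 < v 1 := by
    by_contra hc
    push Not at hc
    have : v 1 * (n + 1/2) ≤ 0 := mul_nonpos_of_nonpos_of_nonneg hc (by positivity)
    linarith
  rcases (mem_V v).1 h with h | ⟨m, hm, h | h | h⟩
  · exact absurd h.2 hy.ne'
  · rw [← h.2] at ha hb
    have ha := lt_of_mul_lt_mul_left ha hy.le
    have hb := lt_of_mul_lt_mul_left hb hy.le
    have ha : 2 * (m:ℝ) < 2 * n + 1 := by linarith
    have hb : 2 * (n:ℝ) < 2 * m + 1 := by linarith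
    norm_cast at ha hb
    obtain rfl : m = n := by omega
    exact .inl h
  · rw [← h.2] at ha hb
    have ha := lt_of_mul_lt_mul_left ha hy.le
    have hb := lt_of_mul_lt_mul_left hb hy.le
    have ha : 2 * (m:ℝ) < 2 * n := by linarith
    have hb : 2 * (n:ℝ) < 2 * m + 2 := by linarith
    norm_cast at ha hb
    omega
  · have h' := h
    obtain ⟨-, h0, hc, hd⟩ := h
    rw [← h0] at hc hd
    have ha := lt_of_mul_lt_mul_left (hc.trans_lt ha) hy.le
    have hb := lt_of_mul_lt_mul_left (hb.trans_le hd) hy.le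
    have ha : 2 * (m:ℝ) < 2 * n + 1 := by linarith
    have hb : 2 * (n:ℝ) < 2 * m + 2 := by linarith
    norm_cast at ha hb
    obtain rfl : m = n := by omega
    exact .inr h'

lemma near_B {v : Fin 4 → ℝ} (h : v ∈ V) {n : ℕ} (hx : 0 < v 0) (ha : v 0 < v 1 * (n + 1))
    (hb : v 1 * n < v 0) : v ∈ B n := by
  have hy : 0 < v 1 := by
    by_contra hc
    push Not at hc
    have : v 1 * (n + 1) ≤ 0 := mul_nonpos_of_nonpos_of_nonneg hc (by positivity)
    linarith
  rcases (mem_V v).1 h with h | ⟨m, hm, h | h | h⟩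
  · exact absurd h.2 hy.ne'
  · rw [← h.2] at ha hb
    have ha := lt_of_mul_lt_mul_left ha hy.le
    have hb := lt_of_mul_lt_mul_left hb hy.le
    norm_cast at ha hb
    omega
  · rw [← h.2] at ha hb
    have ha := lt_of_mul_lt_mul_left ha hy.le
    have hb := lt_of_mul_lt_mul_left hb hy.le
    have ha : 2 * (m:ℝ) + 1 < 2 * n + 2 := by linarith
    have hb : 2 * (n:ℝ) < 2 * m + 1 := by linarith
    norm_cast at ha hb
    obtain rfl : m = n := by omega
    exact .inl h
  · have h' := h
    obtain ⟨-, h0, hc, hd⟩ := h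
    rw [← h0] at hc hd
    have ha := lt_of_mul_lt_mul_left (hc.trans_lt ha) hy.le
    have hb := lt_of_mul_lt_mul_left (hb.trans_le hd) hy.le
    have hb : 2 * (n:ℝ) < 2 * m + 1 := by linarith
    have ha : (m:ℝ) < n + 1 := ha
    norm_cast at ha hb
    obtain rfl : m = n := by omega
    exact .inr h'

lemma E3_pos {v : Fin 4 → ℝ} {n : ℕ} (h : v ∈ E3 n) : 0 < v 1 := by
  by_contra hc
  push Not at hc
  have : v 1 * (n + 1/2) ≤ 0 := mul_nonpos_of_nonpos_of_nonneg hc (by positivity)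
  linarith [h.2.2.2]

lemma E3_unique {v : Fin 4 → ℝ} {n m : ℕ} (h : v ∈ E3 n) (h' : v ∈ E3 m) : n = m := by
  have hy := E3_pos h
  have ha := le_of_mul_le_mul_left (h.2.2.1.trans h'.2.2.2) hy
  have hb := le_of_mul_le_mul_left (h'.2.2.1.trans h.2.2.2) hy
  have ha : 2 * (n:ℝ) ≤ 2 * m + 1 := by linarith
  have hb : 2 * (m:ℝ) ≤ 2 * n + 1 := by linarith
  norm_cast at ha hb
  omega

lemma E1_top {v : Fin 4 → ℝ} {n : ℕ} (h : v ∈ E1 n) (h1 : v 0 = 1) : v ∈ E3 n := by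
  refine ⟨h.1, h1, (h.2.trans h1).le, ?_⟩
  have := h.2.trans h1
  have : 0 ≤ v 1 := by
    by_contra hc
    push Not at hc
    have : v 1 * n ≤ 0 := mul_nonpos_of_nonpos_of_nonneg hc.le (by positivity)
    linarith
  nlinarith

lemma E2_top {v : Fin 4 → ℝ} {n : ℕ} (h : v ∈ E2 n) (h1 : v 0 = 1) : v ∈ E3 n := by
  refine ⟨h.1, h1, ?_, (h.2.trans h1).ge⟩
  have := h.2.trans h1
  have : 0 ≤ v 1 := by
    by_contra hc
    push Not at hc
    have : v 1 * (n+1/2) ≤ 0 := mul_nonpos_of_nonpos_of_nonneg hc.le (by positivity)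
    linarith
  nlinarith

noncomputable abbrev org : ↥V := ⟨pt 0 0, SG_sub o_SG⟩
abbrev gp (a : ↥V) : FundamentalGroupoid ↥V := FundamentalGroupoid.mk a

/-- the arrow is represented by a path inside `T` -/
def InT (T : Set (Fin 4 → ℝ)) {a b : ↥V} (φ : gp a ⟶ gp b) : Prop :=
  ∃ p : Path a b, (∀ t, (p t : Fin 4 → ℝ) ∈ T) ∧
    FundamentalGroupoid.fromPath (Path.Homotopic.Quotient.mk p) = φ

lemma InT.mono {S T : Set (Fin 4 → ℝ)} (h : S ⊆ T) {a b : ↥V} {φ : gp a ⟶ gp b} (hφ : InT S φ) :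
    InT T φ := by
  obtain ⟨p, hp, e⟩ := hφ
  exact ⟨p, fun t => h (hp t), e⟩

lemma InT.comp {T : Set (Fin 4 → ℝ)} {a b c : ↥V} {φ : gp a ⟶ gp b} {ψ : gp b ⟶ gp c}
    (hφ : InT T φ) (hψ : InT T ψ) : InT T (φ ≫ ψ) := by
  obtain ⟨p, hp, rfl⟩ := hφ
  obtain ⟨q, hq, rfl⟩ := hψ
  refine ⟨p.trans q, fun t => ?_, rfl⟩
  rw [Path.trans_apply]
  split_ifs
  · exact hp _
  · exact hq _

lemma InT.inv {T : Set (Fin 4 → ℝ)} {a b : ↥V} {φ : gp a ⟶ gp b}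
    (hφ : InT T φ) : InT T (Groupoid.inv φ) := by
  obtain ⟨p, hp, rfl⟩ := hφ
  exact ⟨p.symm, fun t => hp _, rfl⟩

lemma InT.refl {T : Set (Fin 4 → ℝ)} {a : ↥V} (h : (a : Fin 4 → ℝ) ∈ T) : InT T (𝟙 (gp a)) :=
  ⟨Path.refl a, fun _ => h, rfl⟩

lemma InT.uniq {T : Set (Fin 4 → ℝ)} (hT : T ⊆ V) {c} (hs : StarConvex ℝ c T) {a b : ↥V}
    {φ ψ : gp a ⟶ gp b} (hφ : InT T φ) (hψ : InT T ψ) : φ = ψ := by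
  obtain ⟨p, hp, rfl⟩ := hφ
  obtain ⟨q, hq, rfl⟩ := hψ
  have ha : (a : Fin 4 → ℝ) ∈ T := by simpa using hp 0
  have hb : (b : Fin 4 → ℝ) ∈ T := by simpa using hp 1
  haveI := hs.contractibleSpace ⟨_, ha⟩
  let p' : Path (⟨a, ha⟩ : T) ⟨b, hb⟩ := ⟨⟨fun t => ⟨p t, hp t⟩, by fun_prop⟩, by simp, by simp⟩
  let q' : Path (⟨a, ha⟩ : T) ⟨b, hb⟩ := ⟨⟨fun t => ⟨q t, hq t⟩, by fun_prop⟩, by simp, by simp⟩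
  have h := (SimplyConnectedSpace.paths_homotopic p' q').map ⟨Set.inclusion hT, continuous_inclusion hT⟩
  rw [FundamentalGroupoid.fromPath_eq_iff_homotopic]
  exact h

lemma InT.exists {T : Set (Fin 4 → ℝ)} (hT : T ⊆ V) {c} (hs : StarConvex ℝ c T) {a b : ↥V}
    (ha : (a : Fin 4 → ℝ) ∈ T) (hb : (b : Fin 4 → ℝ) ∈ T) : ∃ φ : gp a ⟶ gp b, InT T φ := by
  haveI := hs.contractibleSpace ⟨_, ha⟩
  have p := PathConnectedSpace.somePath (⟨a, ha⟩ : T) ⟨b, hb⟩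
  refine ⟨_, p.map (continuous_inclusion hT), fun t => (p t).2, rfl⟩

def Can (a : ↥V) (κ : gp org ⟶ gp a) : Prop :=
  ((a : Fin 4 → ℝ) ∈ U1 → InT U1 κ) ∧ ((a : Fin 4 → ℝ) ∈ SG → InT SG κ) ∧
  (∀ n, 1 ≤ n → (a : Fin 4 → ℝ) ∈ A n → InT (A n) κ) ∧
  (∀ n, 1 ≤ n → (a : Fin 4 → ℝ) ∈ E2 n → (a : Fin 4 → ℝ) ∈ U1 → InT (B n) κ)

lemma seg_sub {T : Set (Fin 4 → ℝ)} {v} (hs : StarConvex ℝ (pt 0 0) T) (h : v ∈ T) :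
    segment ℝ (pt 0 0) v ⊆ T := starConvex_iff_segment_subset.1 hs h

lemma exists_can (a : ↥V) : ∃ κ, Can a κ := by
  have hp := V_pl a.2
  by_cases h : (a : Fin 4 → ℝ) ∈ U1
  · have hsub := seg_sub U1_star h
    obtain ⟨κ, hκ⟩ := InT.exists (a := org) (b := a) (hsub.trans U1_sub)
      ((convex_segment (𝕜 := ℝ) (pt 0 0) (a : Fin 4 → ℝ)).starConvex (left_mem_segment _ _ _))
      (left_mem_segment _ _ _) (right_mem_segment _ _ _)
    refine ⟨κ, fun _ => hκ.mono hsub, fun h' => hκ.mono (seg_sub (SG_convex.starConvex o_SG) h'),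
      fun n hn h' => ?_, fun n hn h' _ => ?_⟩
    · rcases h' with h' | h'
      · exact hκ.mono ((seg_sub ((E1_convex hn).starConvex o_E1) h').trans subset_union_left)
      · exact absurd h'.2.1 h.2.ne
    · exact hκ.mono ((seg_sub ((E2_convex n).starConvex o_E2) h').trans subset_union_left)
  · have h1 : (a : Fin 4 → ℝ) 0 = 1 := by
      by_contra hc
      exact h ⟨a.2, lt_of_le_of_ne hp.2.2.2 hc⟩
    by_cases hS : (a : Fin 4 → ℝ) ∈ SG
    · obtain ⟨κ, hκ⟩ := InT.exists (a := org) (b := a) SG_sub (SG_convex.starConvex o_SG) o_SG hS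
      refine ⟨κ, fun h' => absurd h' h, fun _ => hκ, fun n hn h' => ?_, fun n hn _ h' => absurd h' h⟩
      have : (a : Fin 4 → ℝ) ∈ E3 n := h'.elim (fun h' => E1_top h' h1) id
      exact absurd hS.2 (E3_pos this).ne'
    · obtain ⟨n, hn, h3⟩ : ∃ n, 1 ≤ n ∧ (a : Fin 4 → ℝ) ∈ E3 n := by
        rcases (mem_V _).1 a.2 with h' | ⟨n, hn, h' | h' | h'⟩
        · exact absurd h' hS
        · exact ⟨n, hn, E1_top h' h1⟩
        · exact ⟨n, hn, E2_top h' h1⟩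
        · exact ⟨n, hn, h'⟩
      obtain ⟨κ, hκ⟩ := InT.exists (a := org) (b := a) (A_sub hn) (A_star hn) (.inl o_E1) (.inr h3)
      refine ⟨κ, fun h' => absurd h' h, fun h' => absurd h' hS, fun m hm h' => ?_,
        fun n hn _ h' => absurd h' h⟩
      have : (a : Fin 4 → ℝ) ∈ E3 m := h'.elim (fun h' => E1_top h' h1) id
      obtain rfl := E3_unique h3 this
      exact hκ

noncomputable def κ (a : ↥V) : gp org ⟶ gp a := (exists_can a).choose
lemma κ_can (a : ↥V) : Can a (κ a) := (exists_can a).choose_spec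

lemma κ_org : κ org = 𝟙 _ :=
  InT.uniq U1_sub U1_star ((κ_can org).1 o_U1) (InT.refl o_U1)

/-- the straight path -/
noncomputable def sp (a b : ↥V) (h : segment ℝ (a : Fin 4 → ℝ) b ⊆ V) : Path a b where
  toFun t := ⟨AffineMap.lineMap (a : Fin 4 → ℝ) b (t : ℝ), h (by
    rw [segment_eq_image_lineMap]; exact ⟨t, t.2, rfl⟩)⟩
  continuous_toFun := by
    refine Continuous.subtype_mk ?_ _
    exact AffineMap.lineMap_continuous.comp continuous_subtype_val
  source' := by simp
  target' := by simp

lemma sp_mem (a b : ↥V) (h : segment ℝ (a : Fin 4 → ℝ) b ⊆ V) (t) :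
    (sp a b h t : Fin 4 → ℝ) ∈ segment ℝ (a : Fin 4 → ℝ) b := by
  rw [segment_eq_image_lineMap]; exact ⟨t, t.2, rfl⟩

lemma sp_range (a b : ↥V) (h : segment ℝ (a : Fin 4 → ℝ) b ⊆ V) :
    Subtype.val '' (range (sp a b h)) = segment ℝ (a : Fin 4 → ℝ) b := by
  rw [segment_eq_image_lineMap]
  ext v; constructor
  · rintro ⟨_, ⟨t, rfl⟩, rfl⟩; exact ⟨t, t.2, rfl⟩
  · rintro ⟨t, ht, rfl⟩; exact ⟨_, ⟨⟨t, ht⟩, rfl⟩, rfl⟩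

abbrev ι := {n : ℕ // 1 ≤ n}
noncomputable abbrev C1 (n : ι) : ↥V := ⟨c1 n, E1_sub n.2 (c1_E1 n.2)⟩
noncomputable abbrev C2 (n : ι) : ↥V := ⟨c2 n, E2_sub n.2 (c2_E2 n)⟩

noncomputable def q1 (n : ι) : Path org (C1 n) := sp _ _ ((E1_eq n n.2).trans_subset (E1_sub n.2))
noncomputable def q3 (n : ι) : Path (C1 n) (C2 n) := sp _ _ ((E3_eq n n.2).trans_subset (E3_sub n.2))
noncomputable def q2 (n : ι) : Path (C2 n) org :=
  sp _ _ (((segment_symm ℝ _ _).trans (E2_eq n)).trans_subset (E2_sub n.2))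
noncomputable def lpt (n : ι) : Path org org := (q1 n).trans ((q3 n).trans (q2 n))

lemma q1_mem (n : ι) (t) : (q1 n t : Fin 4 → ℝ) ∈ E1 n := by
  have h := sp_mem org (C1 n) ((E1_eq n n.2).trans_subset (E1_sub n.2)) t
  exact (E1_eq n n.2).subset h
lemma q3_mem (n : ι) (t) : (q3 n t : Fin 4 → ℝ) ∈ E3 n := by
  have h := sp_mem (C1 n) (C2 n) ((E3_eq n n.2).trans_subset (E3_sub n.2)) t
  exact (E3_eq n n.2).subset h
lemma q2_mem (n : ι) (t) : (q2 n t : Fin 4 → ℝ) ∈ E2 n := by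
  have h := sp_mem (C2 n) org (((segment_symm ℝ _ _).trans (E2_eq n)).trans_subset (E2_sub n.2)) t
  exact ((segment_symm ℝ _ _).trans (E2_eq n)).subset h

lemma q1_range (n : ι) : Subtype.val '' (range (q1 n)) = segment ℝ (pt 0 0) (pt 1 (1 / ((n : ℕ) : ℝ))) :=
  sp_range org (C1 n) ((E1_eq n n.2).trans_subset (E1_sub n.2))
lemma q3_range (n : ι) : Subtype.val '' (range (q3 n)) =
    segment ℝ (pt 1 (1 / ((n : ℕ) : ℝ))) (pt 1 (1 / (((n : ℕ) : ℝ) + 1 / 2))) :=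
  sp_range (C1 n) (C2 n) ((E3_eq n n.2).trans_subset (E3_sub n.2))
lemma q2_range (n : ι) : Subtype.val '' (range (q2 n)) =
    segment ℝ (pt 0 0) (pt 1 (1 / (((n : ℕ) : ℝ) + 1 / 2))) :=
  (sp_range (C2 n) org (((segment_symm ℝ _ _).trans (E2_eq n)).trans_subset (E2_sub n.2))).trans
    (segment_symm ℝ _ _)

lemma lpt_range (n : ι) : (Set.range fun t => (lpt n t : Fin 4 → ℝ)) = tri n := by
  have : (Set.range fun t => (lpt n t : Fin 4 → ℝ)) = Subtype.val '' range (lpt n) := by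
    rw [← range_comp]; rfl
  rw [this, lpt, Path.trans_range, Path.trans_range, image_union, image_union, q1_range, q2_range,
    q3_range, tri, union_assoc, union_comm (segment ℝ (pt 1 (1 / ((n : ℕ) : ℝ))) _)]

lemma lpt_corners (n : ι) : ∃ t₁ t₂ : unitInterval, t₁ < t₂ ∧
          (lpt n t₁ : Fin 4 → ℝ) = pt 1 (1 / ((n : ℕ) : ℝ)) ∧
          (lpt n t₂ : Fin 4 → ℝ) = pt 1 (1 / (((n : ℕ) : ℝ) + 1 / 2)) := by
  have m1 : (1/2 : ℝ) ∈ unitInterval := ⟨by norm_num, by norm_num⟩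
  have m2 : (3/4 : ℝ) ∈ unitInterval := ⟨by norm_num, by norm_num⟩
  refine ⟨⟨1/2, m1⟩, ⟨3/4, m2⟩, ?_, ?_, ?_⟩
  · show (1/2 : ℝ) < 3/4
    norm_num
  · have : lpt n ⟨1/2, m1⟩ = C1 n := by
      rw [lpt, Path.trans_apply]; norm_num
    rw [this]; rfl
  · have : lpt n ⟨3/4, m2⟩ = C2 n := by
      rw [lpt, Path.trans_apply, dif_neg (by norm_num), Path.trans_apply, dif_pos (by norm_num)]
      norm_num
    rw [this]; rfl

noncomputable def γ (n : ι) : FundamentalGroup ↥V org := FundamentalGroup.fromPath (Path.Homotopic.Quotient.mk (lpt n))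

noncomputable def α (n : ι) : gp org ⟶ gp (C2 n) :=
  FundamentalGroupoid.fromPath (Path.Homotopic.Quotient.mk (q1 n)) ≫
  FundamentalGroupoid.fromPath (Path.Homotopic.Quotient.mk (q3 n))
noncomputable def β (n : ι) : gp (C2 n) ⟶ gp org :=
  FundamentalGroupoid.fromPath (Path.Homotopic.Quotient.mk (q2 n))

lemma γ_eq (n : ι) : γ n = α n ≫ β n := by
  rw [α, Category.assoc]; rfl

lemma α_in (n : ι) : InT (A n) (α n) :=
  InT.comp ⟨_, fun t => .inl (q1_mem n t), rfl⟩ ⟨_, fun t => .inr (q3_mem n t), rfl⟩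
lemma β_in (n : ι) : InT (B n) (β n) := ⟨_, fun t => .inl (q2_mem n t), rfl⟩

noncomputable def H : Subgroup (FundamentalGroup ↥V org) := (FreeGroup.lift γ).range

lemma γ_H (n : ι) : γ n ∈ H := ⟨FreeGroup.of n, by simp⟩

def R {a b : ↥V} (φ : gp a ⟶ gp b) : Prop :=
  (show FundamentalGroup ↥V org from κ a ≫ φ ≫ Groupoid.inv (κ b)) ∈ H

lemma H_mul {φ ψ : gp org ⟶ gp org} (h : φ ∈ H) (h' : ψ ∈ H) : φ ≫ ψ ∈ H := H.mul_mem h' h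
lemma H_inv {φ : gp org ⟶ gp org} (h : φ ∈ H) : Groupoid.inv φ ∈ H := H.inv_mem h
lemma H_one : 𝟙 (gp org) ∈ H := H.one_mem

lemma ginv_comp {a b c : ↥V} (φ : gp a ⟶ gp b) (ψ : gp b ⟶ gp c) :
    Groupoid.inv (φ ≫ ψ) = Groupoid.inv ψ ≫ Groupoid.inv φ := by
  simp [Groupoid.inv_eq_inv]

lemma R_comp {a b c : ↥V} {φ : gp a ⟶ gp b} {ψ : gp b ⟶ gp c} (h : R φ) (h' : R ψ) :
    R (φ ≫ ψ) := by
  have := H_mul h h'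
  simpa [R, Groupoid.inv_eq_inv] using this

lemma R_inv {a b : ↥V} {φ : gp a ⟶ gp b} (h : R φ) : R (Groupoid.inv φ) := by
  have := H_inv h
  simpa [R, Groupoid.inv_eq_inv] using this

lemma R_of_eq {a b : ↥V} {φ : gp a ⟶ gp b} (h : κ a ≫ φ = κ b) : R φ := by
  have := H_one
  rw [R, ← Category.assoc, h]
  simpa [Groupoid.inv_eq_inv] using this

lemma R_of_star {T : Set (Fin 4 → ℝ)} (hT : T ⊆ V) {c} (hs : StarConvex ℝ c T) {a b : ↥V}
    {φ : gp a ⟶ gp b} (hφ : InT T φ) (ha : InT T (κ a)) (hb : InT T (κ b)) : R φ :=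
  R_of_eq (InT.uniq hT hs (ha.comp hφ) hb)

lemma B_aux (n : ι) {a : ↥V} {ρ : gp org ⟶ gp a} (hρ : InT (B n) ρ) (ha : (a : Fin 4 → ℝ) ∈ B n) :
    κ a ≫ Groupoid.inv ρ ∈ H := by
  by_cases h : (a : Fin 4 → ℝ) ∈ U1
  · have h2 : (a : Fin 4 → ℝ) ∈ E2 n := by
      rcases ha with ha | ha
      · exact ha
      · exact absurd ha.2.1 h.2.ne
    have : κ a = ρ := InT.uniq (B_sub n.2) (B_star n.2) ((κ_can a).2.2.2 n n.2 h2 h) hρ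
    rw [this]
    simpa [Groupoid.inv_eq_inv] using H_one
  · have h1 : (a : Fin 4 → ℝ) 0 = 1 := by
      by_contra hc
      exact h ⟨a.2, lt_of_le_of_ne (V_pl a.2).2.2.2 hc⟩
    have h3 : (a : Fin 4 → ℝ) ∈ E3 n := ha.elim (fun h' => E2_top h' h1) id
    obtain ⟨δ, hδ⟩ := InT.exists (a := C2 n) (b := a) (E3_sub n.2)
      ((E3_convex n.2).starConvex h3) (c2_E3 n.2) h3
    have e1 : κ a = α n ≫ δ := InT.uniq (A_sub n.2) (A_star n.2)
      ((κ_can a).2.2.1 n n.2 (.inr h3)) ((α_in n).comp (hδ.mono subset_union_right))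
    have e2 : ρ = Groupoid.inv (β n) ≫ δ := InT.uniq (B_sub n.2) (B_star n.2) hρ
      ((β_in n).inv.comp (hδ.mono subset_union_right))
    have := γ_H n
    rw [γ_eq] at this
    rw [e1, e2]
    simpa [Groupoid.inv_eq_inv] using this

lemma R_of_B (n : ι) {a b : ↥V} {φ : gp a ⟶ gp b} (hφ : InT (B n) φ)
    (ha : (a : Fin 4 → ℝ) ∈ B n) (hb : (b : Fin 4 → ℝ) ∈ B n) : R φ := by
  obtain ⟨ρ, hρ⟩ := InT.exists (a := org) (b := a) (B_sub n.2) (B_star n.2) (.inl o_E2) ha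
  have h1 := B_aux n hρ ha
  have h2 := B_aux n (hρ.comp hφ) hb
  have := H_mul h1 (H_inv h2)
  simpa [R, Groupoid.inv_eq_inv] using this

lemma R_local {a b : ↥V} (p : Path a b) (s : unitInterval) : ∀ᶠ t in 𝓝 s,
    R (FundamentalGroupoid.fromPath (Path.Homotopic.Quotient.mk (p.subpath s t))) := by
  have hcoord : ∀ i : Fin 4, Continuous fun t => (p t : Fin 4 → ℝ) i := fun i =>
    (continuous_apply i).comp (continuous_subtype_val.comp p.continuous)
  have small : ∀ {P : unitInterval → Prop}, (∀ᶠ t in 𝓝 s, P t) →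
      ∀ᶠ t in 𝓝 s, ∀ u ∈ uIcc s t, P u := by
    intro P hP
    have h1 : Tendsto (fun t => uIcc s t) (𝓝 s) (𝓝 s).smallSets :=
      tendsto_const_nhds.uIcc tendsto_id
    exact h1.eventually (eventually_smallSets_forall.2 hP)
  have key : ∀ (T : Set (Fin 4 → ℝ)) (t), (∀ u ∈ uIcc s t, (p u : Fin 4 → ℝ) ∈ T) →
      InT T (FundamentalGroupoid.fromPath (Path.Homotopic.Quotient.mk (p.subpath s t))) ∧
      (p s : Fin 4 → ℝ) ∈ T ∧ (p t : Fin 4 → ℝ) ∈ T := by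
    intro T t h
    refine ⟨⟨_, fun u => ?_, rfl⟩, h s left_mem_uIcc, h t right_mem_uIcc⟩
    have : p.subpath s t u ∈ p '' uIcc s t := by
      rw [← Path.range_subpath]; exact ⟨u, rfl⟩
    obtain ⟨w, hw, e⟩ := this
    rw [← e]; exact h w hw
  have hps := V_pl (p s).2
  by_cases h : (p s : Fin 4 → ℝ) ∈ U1
  · have : ∀ᶠ t in 𝓝 s, (p t : Fin 4 → ℝ) 0 < 1 :=
      (hcoord 0).continuousAt.eventually_lt continuousAt_const h.2
    filter_upwards [small this] with t ht
    obtain ⟨k1, k2, k3⟩ := key U1 t (fun u hu => ⟨(p u).2, ht u hu⟩)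
    exact R_of_star U1_sub U1_star k1 ((κ_can _).1 k2) ((κ_can _).1 k3)
  have h1 : (p s : Fin 4 → ℝ) 0 = 1 := by
    by_contra hc
    exact h ⟨(p s).2, lt_of_le_of_ne hps.2.2.2 hc⟩
  have hx : ∀ᶠ t in 𝓝 s, 0 < (p t : Fin 4 → ℝ) 0 :=
    continuousAt_const.eventually_lt (hcoord 0).continuousAt (by rw [h1]; norm_num)
  by_cases hS : (p s : Fin 4 → ℝ) ∈ SG
  · filter_upwards [small hx] with t ht
    obtain ⟨k1, k2, k3⟩ := key SG t (fun u hu => by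
      refine ⟨V_pl (p u).2, ?_⟩
      by_contra hy
      have hy : 0 < (p u : Fin 4 → ℝ) 1 := by
        have hxu := ht u hu
        refine lt_of_le_of_ne ?_ (Ne.symm hy)
        by_contra hc
        push Not at hc
        rcases (mem_V _).1 (p u).2 with h' | ⟨n, hn, h' | h' | h'⟩
        · exact hy h'.2
        · have := h'.2
          have : (p u : Fin 4 → ℝ) 1 * n ≤ 0 := mul_nonpos_of_nonpos_of_nonneg hc.le (by positivity)
          linarith
        · have := h'.2
          have : (p u : Fin 4 → ℝ) 1 * (n + 1/2) ≤ 0 := mul_nonpos_of_nonpos_of_nonneg hc.le (by positivity)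
          linarith
        · exact absurd (E3_pos h') hc.not_gt
      obtain ⟨n, hn⟩ := exists_nat_gt ((p u : Fin 4 → ℝ) 0 / (p u : Fin 4 → ℝ) 1)
      rw [div_lt_iff₀ hy] at hn
      have hiv := intermediate_value_uIcc (a := s) (b := u)
        (f := fun w => (p w : Fin 4 → ℝ) 1 * (n + 3/4) - (p w : Fin 4 → ℝ) 0)
        (((hcoord 1).mul continuous_const).sub (hcoord 0)).continuousOn
      have h0 : (0:ℝ) ∈ uIcc ((p s : Fin 4 → ℝ) 1 * (n + 3/4) - (p s : Fin 4 → ℝ) 0)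
          ((p u : Fin 4 → ℝ) 1 * (n + 3/4) - (p u : Fin 4 → ℝ) 0) := by
        rw [hS.2, h1]
        refine mem_uIcc_of_le (by norm_num) ?_
        nlinarith
      obtain ⟨w, hw, e⟩ := hiv h0
      have hw' : w ∈ uIcc s t := uIcc_subset_uIcc left_mem_uIcc hu hw
      exact no34 (p w).2 n (ht w hw') (by simp only at e; linarith))
    exact R_of_star SG_sub (SG_convex.starConvex o_SG) k1 ((κ_can _).2.1 k2) ((κ_can _).2.1 k3)
  obtain ⟨n, hn, h3⟩ : ∃ n, 1 ≤ n ∧ (p s : Fin 4 → ℝ) ∈ E3 n := by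
    rcases (mem_V _).1 (p s).2 with h' | ⟨n, hn, h' | h' | h'⟩
    · exact absurd h' hS
    · exact ⟨n, hn, E1_top h' h1⟩
    · exact ⟨n, hn, E2_top h' h1⟩
    · exact ⟨n, hn, h'⟩
  have hy := E3_pos h3
  by_cases hb : (p s : Fin 4 → ℝ) 1 * n < 1
  · have e1 : ∀ᶠ t in 𝓝 s, (p t : Fin 4 → ℝ) 1 * n < (p t : Fin 4 → ℝ) 0 :=
      ((hcoord 1).mul continuous_const).continuousAt.eventually_lt (hcoord 0).continuousAt
        (by rw [h1]; exact hb)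
    have e2 : ∀ᶠ t in 𝓝 s, (p t : Fin 4 → ℝ) 0 < (p t : Fin 4 → ℝ) 1 * (n + 1) :=
      (hcoord 0).continuousAt.eventually_lt ((hcoord 1).mul continuous_const).continuousAt
        (by rw [h1]; linarith [h3.2.2.2])
    filter_upwards [small hx, small e1, small e2] with t ht ht1 ht2
    obtain ⟨k1, k2, k3⟩ := key (B n) t (fun u hu => near_B (p u).2 (ht u hu) (ht2 u hu) (ht1 u hu))
    exact R_of_B ⟨n, hn⟩ k1 k2 k3
  · have hb' : (p s : Fin 4 → ℝ) 1 * n = 1 := le_antisymm h3.2.2.1 (not_lt.1 hb)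
    have e1 : ∀ᶠ t in 𝓝 s, (p t : Fin 4 → ℝ) 1 * (n - 1/2) < (p t : Fin 4 → ℝ) 0 :=
      ((hcoord 1).mul continuous_const).continuousAt.eventually_lt (hcoord 0).continuousAt
        (by show (p s : Fin 4 → ℝ) 1 * (n - 1/2) < (p s : Fin 4 → ℝ) 0; rw [h1]; linarith)
    have e2 : ∀ᶠ t in 𝓝 s, (p t : Fin 4 → ℝ) 0 < (p t : Fin 4 → ℝ) 1 * (n + 1/2) :=
      (hcoord 0).continuousAt.eventually_lt ((hcoord 1).mul continuous_const).continuousAt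
        (by show (p s : Fin 4 → ℝ) 0 < (p s : Fin 4 → ℝ) 1 * (n + 1/2); rw [h1]; linarith)
    filter_upwards [small hx, small e1, small e2] with t ht ht1 ht2
    obtain ⟨k1, k2, k3⟩ := key (A n) t (fun u hu => near_A (p u).2 (ht u hu) (ht2 u hu) (ht1 u hu))
    exact R_of_star (A_sub hn) (A_star hn) k1 ((κ_can _).2.2.1 n hn k2) ((κ_can _).2.2.1 n hn k3)

lemma R_cast {a b a' b' : ↥V} (p : Path a b) (ha : a' = a) (hb : b' = b)
    (h : R (FundamentalGroupoid.fromPath (Path.Homotopic.Quotient.mk (p.cast ha hb)))) :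
    R (FundamentalGroupoid.fromPath (Path.Homotopic.Quotient.mk p)) := by
  subst ha hb; exact h

lemma R_all {a b : ↥V} (p : Path a b) :
    R (FundamentalGroupoid.fromPath (Path.Homotopic.Quotient.mk p)) := by
  apply R_cast p p.source p.target
  rw [← Path.subpath_zero_one]
  haveI : Std.Symm (fun s t : unitInterval =>
    R (FundamentalGroupoid.fromPath (Path.Homotopic.Quotient.mk (p.subpath s t)))) := ⟨fun s t h => by
      rw [← Path.symm_subpath]; exact R_inv h⟩
  refine PreconnectedSpace.induction₂ (fun s t : unitInterval =>
    R (FundamentalGroupoid.fromPath (Path.Homotopic.Quotient.mk (p.subpath s t)))) (R_local p)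
    ⟨fun s t u h h' => ?_⟩ 0 1
  have := R_comp h h'
  convert this using 1
  exact ((FundamentalGroupoid.fromPath_eq_iff_homotopic _ _).2
    ⟨Path.Homotopy.subpathTransSubpath p s t u⟩).symm

lemma lift_surj : Function.Surjective (FreeGroup.lift γ) := by
  intro x
  obtain ⟨p, rfl⟩ := Path.Homotopic.Quotient.mk_surjective x
  have := R_all p
  rw [R, κ_org] at this
  have h2 : (𝟙 (gp org) ≫ FundamentalGroupoid.fromPath (Path.Homotopic.Quotient.mk p) ≫ Groupoid.inv (𝟙 (gp org)))
     ∈ H := this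
  rw [Groupoid.inv_eq_inv, IsIso.inv_id, Category.comp_id, Category.id_comp] at h2
  exact h2

abbrev Fr := FreeGroup ι
instance frTop : TopologicalSpace Fr := ⊥
instance frDisc : DiscreteTopology Fr := ⟨rfl⟩

def cnd (n : ι) (v : ↥V) : Prop :=
  (v : Fin 4 → ℝ) 0 < (v : Fin 4 → ℝ) 1 * (((n : ℕ) : ℝ) + 3/4) ∧
  (v : Fin 4 → ℝ) 1 * (((n : ℕ) : ℝ) + 1/4) < (v : Fin 4 → ℝ) 0

open Classical in
noncomputable def GG (P : ι → Prop) : Fr := if h : ∃ n, P n then (FreeGroup.of h.choose)⁻¹ else 1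

noncomputable def gg (N : ℕ) (v : ↥V) : Fr := GG fun n => (n : ℕ) ≤ N ∧ cnd n v

open Classical in
noncomputable def θ (N : ℕ) (n : ι) : Fr := if (n : ℕ) ≤ N then FreeGroup.of n else 1

lemma cnd_C1 (n m : ι) : ¬ cnd m (C1 n) := by
  rintro ⟨h1, h2⟩
  have hn : (0:ℝ) < ((n : ℕ) : ℝ) := by exact_mod_cast n.2
  change (1:ℝ) < 1 / ((n : ℕ) : ℝ) * _ at h1
  change 1 / ((n : ℕ) : ℝ) * _ < (1:ℝ) at h2
  rw [one_div, inv_mul_eq_div, one_lt_div hn] at h1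
  rw [one_div, inv_mul_eq_div, div_lt_one hn] at h2
  have h1 : 4 * ((n : ℕ) : ℝ) < 4 * ((m : ℕ) : ℝ) + 3 := by linarith
  have h2 : 4 * ((m : ℕ) : ℝ) + 1 < 4 * ((n : ℕ) : ℝ) := by linarith
  norm_cast at h1 h2
  omega

lemma cnd_C2 (n m : ι) : cnd m (C2 n) ↔ m = n := by
  have hn : (0:ℝ) < ((n : ℕ) : ℝ) + 1/2 := by positivity
  have e1 : cnd m (C2 n) ↔ ((n : ℕ) : ℝ) + 1/2 < ((m : ℕ) : ℝ) + 3/4 ∧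
      ((m : ℕ) : ℝ) + 1/4 < ((n : ℕ) : ℝ) + 1/2 := by
    change ((1:ℝ) < 1 / (((n : ℕ) : ℝ) + 1/2) * _ ∧ 1 / (((n : ℕ) : ℝ) + 1/2) * _ < (1:ℝ)) ↔ _
    rw [one_div (((n : ℕ) : ℝ) + 1/2), inv_mul_eq_div, one_lt_div hn, inv_mul_eq_div, div_lt_one hn]
  rw [e1]
  constructor
  · rintro ⟨h1, h2⟩
    have h1 : 4 * ((n : ℕ) : ℝ) < 4 * ((m : ℕ) : ℝ) + 1 := by linarith
    have h2 : 4 * ((m : ℕ) : ℝ) < 4 * ((n : ℕ) : ℝ) + 1 := by linarith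
    norm_cast at h1 h2
    exact Subtype.ext (by omega)
  · rintro rfl
    constructor <;> linarith

lemma gg_C1 (N : ℕ) (n : ι) : gg N (C1 n) = 1 := by
  rw [gg, GG, dif_neg]
  rintro ⟨m, -, hm⟩
  exact cnd_C1 n m hm

lemma gg_C2 (N : ℕ) (n : ι) : gg N (C2 n) = (θ N n)⁻¹ := by
  rw [gg, GG, θ]
  by_cases h : (n : ℕ) ≤ N
  · have hex : ∃ m : ι, (m : ℕ) ≤ N ∧ cnd m (C2 n) := ⟨n, h, (cnd_C2 n n).2 rfl⟩
    rw [dif_pos hex, if_pos h, (cnd_C2 n _).1 hex.choose_spec.2]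
  · rw [dif_neg, if_neg h, inv_one]
    rintro ⟨m, hm, hm'⟩
    rw [cnd_C2] at hm'
    exact h (hm' ▸ hm)

def O1 (N : ℕ) : Set ↥V :=
  ⋂ n ∈ Finset.range (N+1), {v : ↥V | ¬ ((v : Fin 4 → ℝ) 0 = 1 ∧ (v : Fin 4 → ℝ) 1 * ((n : ℝ) + 1/4) = 1)}
def O2 : Set ↥V := {v : ↥V | 1/2 < (v : Fin 4 → ℝ) 0}

lemma cont_coord (i : Fin 4) : Continuous fun v : ↥V => (v : Fin 4 → ℝ) i :=
  (continuous_apply i).comp continuous_subtype_val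

lemma O1_open (N : ℕ) : IsOpen (O1 N) := by
  refine isOpen_biInter_finset fun n _ => ?_
  have : IsClosed {v : ↥V | (v : Fin 4 → ℝ) 0 = 1 ∧ (v : Fin 4 → ℝ) 1 * ((n : ℝ) + 1/4) = 1} :=
    (isClosed_eq (cont_coord 0) continuous_const).inter
      (isClosed_eq ((cont_coord 1).mul continuous_const) continuous_const)
  exact this.isOpen_compl

lemma O2_open : IsOpen O2 := isOpen_lt continuous_const (cont_coord 0)

lemma not_O1 {N : ℕ} {v : ↥V} (h : v ∉ O1 N) : v ∈ O2 := by
  simp only [O1, mem_iInter, not_forall, mem_setOf_eq, not_not] at h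
  obtain ⟨n, -, h, -⟩ := h
  show (1/2 : ℝ) < (v : Fin 4 → ℝ) 0
  rw [h]; norm_num

lemma lt_iff_ev {f g : ↥V → ℝ} (hf : Continuous f) (hg : Continuous g) {v : ↥V} (h : f v ≠ g v) :
    ∀ᶠ w in 𝓝 v, (f w < g w ↔ f v < g v) := by
  rcases lt_or_gt_of_ne h with h | h
  · filter_upwards [hf.continuousAt.eventually_lt hg.continuousAt h] with w hw
    exact iff_of_true hw h
  · filter_upwards [hg.continuousAt.eventually_lt hf.continuousAt h] with w hw
    exact iff_of_false hw.not_gt h.not_gt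

lemma cnd_ev (N : ℕ) {v : ↥V} (h1 : v ∈ O1 N) (h2 : v ∈ O2) (n : ι) (hn : (n : ℕ) ≤ N) :
    ∀ᶠ w in 𝓝 v, (cnd n w ↔ cnd n v) := by
  have hx : 0 < (v : Fin 4 → ℝ) 0 := lt_trans (by norm_num) (show (1/2 : ℝ) < _ from h2)
  have a1 := no34 v.2 n hx
  have a2 : (v : Fin 4 → ℝ) 1 * (((n : ℕ) : ℝ) + 1/4) ≠ (v : Fin 4 → ℝ) 0 := by
    intro he
    have h3 := no14 v.2 n hx he.symm
    simp only [O1, mem_iInter] at h1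
    exact h1 n (Finset.mem_range.2 (by omega)) ⟨h3, he.trans h3⟩
  filter_upwards [lt_iff_ev (cont_coord 0) ((cont_coord 1).mul continuous_const) a1,
    lt_iff_ev ((cont_coord 1).mul continuous_const) (cont_coord 0) a2] with w b1 b2
  exact and_congr b1 b2

lemma gg_ev (N : ℕ) {v : ↥V} (h1 : v ∈ O1 N) (h2 : v ∈ O2) : ∀ᶠ w in 𝓝 v, gg N w = gg N v := by
  have : ∀ᶠ w in 𝓝 v, ∀ n ∈ {n : ι | (n : ℕ) ≤ N}, (cnd n w ↔ cnd n v) := by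
    have hf : {n : ι | (n : ℕ) ≤ N}.Finite :=
      (Set.finite_Iic N).preimage Subtype.val_injective.injOn
    exact (Filter.eventually_all_finite hf).2 fun n hn => cnd_ev N h1 h2 n hn
  filter_upwards [this] with w hw
  rw [gg, gg]
  congr 1
  funext n
  exact propext (and_congr_right fun hn => hw n hn)

noncomputable def cc (N : ℕ) : Bool → ↥V → Fr
  | true, _ => 1
  | false, v => gg N v

def OO (N : ℕ) : Bool → Set ↥V
  | true => O1 N
  | false => O2

lemma cc_ev (N : ℕ) (i j : Bool) {v : ↥V} (hi : v ∈ OO N i) (hj : v ∈ OO N j) :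
    ∀ᶠ w in 𝓝 v, cc N j w * (cc N i w)⁻¹ = cc N j v * (cc N i v)⁻¹ := by
  cases i <;> cases j
  · simp
  · filter_upwards [gg_ev N hj hi] with w hw
    simp [cc, hw]
  · filter_upwards [gg_ev N hi hj] with w hw
    simp [cc, hw]
  · simp

open Classical in
noncomputable def Z (N : ℕ) : FiberBundleCore Bool ↥V Fr where
  baseSet := OO N
  isOpen_baseSet i := by cases i; exacts [O2_open, O1_open N]
  indexAt v := if v ∈ O1 N then true else false
  mem_baseSet_at v := by
    split_ifs with h
    · exact h
    · exact not_O1 h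
  coordChange i j v f := cc N j v * (cc N i v)⁻¹ * f
  coordChange_self i v _ f := by simp
  continuousOn_coordChange i j := by
    rintro ⟨v, f⟩ ⟨⟨hi, hj⟩, -⟩
    apply ContinuousAt.continuousWithinAt
    have h1 : Continuous fun p : ↥V × Fr => cc N j v * (cc N i v)⁻¹ * p.2 :=
      (continuous_of_discreteTopology (f := fun x : Fr => cc N j v * (cc N i v)⁻¹ * x)).comp
        continuous_snd
    refine h1.continuousAt.congr ?_
    filter_upwards [continuousAt_fst.eventually (cc_ev N i j hi hj)] with p hp
    rw [hp]
  coordChange_comp i j k v _ f := by group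

lemma cov (N : ℕ) : IsCoveringMap (Bundle.TotalSpace.proj : (Z N).TotalSpace → ↥V) :=
  FiberBundle.isCoveringMap

noncomputable def PP (N : ℕ) (v : ↥V) (k : Fr) :
    (Bundle.TotalSpace.proj : (Z N).TotalSpace → ↥V) ⁻¹' {v} :=
  ⟨⟨v, (cc N ((Z N).indexAt v) v * k : Fr)⟩, rfl⟩

lemma PP_inj (N : ℕ) (v : ↥V) {k l : Fr} (h : PP N v k = PP N v l) : k = l := by
  have h := congrArg Subtype.val h
  simp only [PP] at h
  have h := Bundle.TotalSpace.mk_injective v h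
  exact mul_left_cancel h

lemma sec_cont (N : ℕ) (i : Bool) (k : Fr) : ContinuousOn
    (fun v : ↥V => (⟨v, (Z N).coordChange i ((Z N).indexAt v) v k⟩ : (Z N).TotalSpace)) (OO N i) := by
  have h := ((Z N).localTriv i).toOpenPartialHomeomorph.continuousOn_symm
  exact h.comp (f := fun v : ↥V => (v, k)) (by fun_prop) (fun v hv => ⟨hv, mem_univ _⟩)

lemma mono_step (N : ℕ) (i : Bool) {a b : ↥V} (q : Path a b) (hq : ∀ t, q t ∈ OO N i) (k : Fr) :
    (cov N).monodromy (Path.Homotopic.Quotient.mk q) (PP N a k) =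
      PP N b ((cc N i b)⁻¹ * cc N i a * k) := by
  let s : ↥V → (Z N).TotalSpace := fun v => ⟨v, (Z N).coordChange i ((Z N).indexAt v) v (cc N i a * k)⟩
  have hs : Continuous fun t => s (q t) :=
    (sec_cont N i _).comp_continuous q.continuous hq
  have ea : s a = (PP N a k).1 := by
    show (⟨a, (_ : Fr)⟩ : (Z N).TotalSpace) = ⟨a, (_ : Fr)⟩
    congr 1
    show cc N _ a * (cc N i a)⁻¹ * (cc N i a * k) = _
    group
  have eb : s b = (PP N b ((cc N i b)⁻¹ * cc N i a * k)).1 := by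
    show (⟨b, (_ : Fr)⟩ : (Z N).TotalSpace) = ⟨b, (_ : Fr)⟩
    congr 1
    show cc N _ b * (cc N i b)⁻¹ * (cc N i a * k) = _
    group
  let Γ : Path (PP N a k).1 (PP N b ((cc N i b)⁻¹ * cc N i a * k)).1 :=
    ⟨⟨_, hs⟩, by simpa using ea, by simpa using eb⟩
  refine (cov N).monodromy_eq_of_map_eq (Path.Homotopic.Quotient.mk Γ) ?_
  refine congrArg Path.Homotopic.Quotient.mk ?_
  ext1
  rfl

lemma q1_O (N : ℕ) (n : ι) (t) : q1 n t ∈ OO N true := by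
  simp only [OO, O1, mem_iInter]
  rintro m - ⟨h1, h2⟩
  have h3 := E1_top (q1_mem n t) h1
  have hy := E3_pos h3
  have h4 := (q1_mem n t).2
  rw [h1, ← h2] at h4
  have := mul_left_cancel₀ hy.ne' h4
  have : 4 * ((n : ℕ) : ℝ) = 4 * m + 1 := by linarith
  norm_cast at this
  omega

lemma q2_O (N : ℕ) (n : ι) (t) : q2 n t ∈ OO N true := by
  simp only [OO, O1, mem_iInter]
  rintro m - ⟨h1, h2⟩
  have h3 := E2_top (q2_mem n t) h1
  have hy := E3_pos h3
  have h4 := (q2_mem n t).2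
  rw [h1, ← h2] at h4
  have := mul_left_cancel₀ hy.ne' h4
  have : 4 * ((n : ℕ) : ℝ) + 1 = 4 * m := by linarith
  norm_cast at this
  omega

lemma q3_O (N : ℕ) (n : ι) (t) : q3 n t ∈ OO N false := by
  show (1/2 : ℝ) < (q3 n t : Fin 4 → ℝ) 0
  rw [(q3_mem n t).2.1]; norm_num

lemma mono_γ (N : ℕ) (n : ι) (f : Fr) :
    (cov N).monodromyPerm org (γ n) (PP N org f) = PP N org (θ N n * f) := by
  have h : (cov N).monodromy ((Path.Homotopic.Quotient.mk (q1 n)).trans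
      ((Path.Homotopic.Quotient.mk (q3 n)).trans (Path.Homotopic.Quotient.mk (q2 n)))) (PP N org f) =
      PP N org (θ N n * f) := by
    rw [IsCoveringMap.monodromy_trans_apply, IsCoveringMap.monodromy_trans_apply,
      mono_step N true _ (q1_O N n), mono_step N false _ (q3_O N n), mono_step N true _ (q2_O N n)]
    congr 1
    simp [cc, gg_C1, gg_C2]
  exact h

lemma mono_lift (N : ℕ) (w : Fr) : ∀ f, 
    (cov N).monodromyPerm org (FreeGroup.lift γ w) (PP N org f) =
      PP N org (FreeGroup.lift (θ N) w * f) := by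
  induction w using FreeGroup.induction_on with
  | C1 => intro f; rw [map_one, map_one, Equiv.Perm.one_apply, map_one, one_mul]
  | of n => intro f; rw [FreeGroup.lift_apply_of, FreeGroup.lift_apply_of]; exact mono_γ N n f
  | inv_of n ih =>
    intro f
    rw [map_inv, map_inv, Equiv.Perm.inv_eq_iff_eq, ih, map_inv, mul_inv_cancel_left]
  | mul x y hx hy =>
    intro f
    rw [map_mul, map_mul, Equiv.Perm.mul_apply, hy, hx, map_mul, mul_assoc]

lemma θ_lift (w : Fr) : ∃ N0, ∀ N ≥ N0, FreeGroup.lift (θ N) w = w := by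
  induction w using FreeGroup.induction_on with
  | C1 => exact ⟨0, fun N _ => map_one _⟩
  | of n => exact ⟨n, fun N hN => by rw [FreeGroup.lift_apply_of, θ, if_pos hN]⟩
  | inv_of n ih =>
    obtain ⟨N0, h⟩ := ih
    exact ⟨N0, fun N hN => by rw [map_inv, h N hN]⟩
  | mul x y hx hy =>
    obtain ⟨N0, h⟩ := hx
    obtain ⟨N1, h'⟩ := hy
    exact ⟨max N0 N1, fun N hN => by
      rw [map_mul, h N (le_trans (le_max_left _ _) hN), h' N (le_trans (le_max_right _ _) hN)]⟩

lemma lift_inj : Function.Injective (FreeGroup.lift γ) := by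
  rw [injective_iff_map_eq_one]
  intro w hw
  obtain ⟨N, hN⟩ := θ_lift w
  have h := mono_lift N w 1
  rw [hw, map_one, Equiv.Perm.one_apply, hN N le_rfl] at h
  have := PP_inj N org h
  simpa using this.symm

/-- The fundamental group of `V` based at the origin is free, with basis the classes of the
loops traversing each triangle boundary `gₙ` (going out along the edge to `(1, 1/n, 0, 0)`,
down to `(1, 1/(n+1/2), 0, 0)`, and back). -/
theorem pi1_V_free_on_triangle_loops (h0 : pt 0 0 ∈ V) :
    ∃ γ : {n : ℕ // 1 ≤ n} → FundamentalGroup ↥V ⟨pt 0 0, h0⟩,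
      (∀ n : {n : ℕ // 1 ≤ n}, ∃ p : Path (⟨pt 0 0, h0⟩ : ↥V) ⟨pt 0 0, h0⟩,
        (Set.range fun t => (p t : Fin 4 → ℝ)) = tri n ∧
        (∃ t₁ t₂ : unitInterval, t₁ < t₂ ∧
          (p t₁ : Fin 4 → ℝ) = pt 1 (1 / ((n : ℕ) : ℝ)) ∧
          (p t₂ : Fin 4 → ℝ) = pt 1 (1 / (((n : ℕ) : ℝ) + 1 / 2))) ∧
        γ n = FundamentalGroup.fromPath (X := TopCat.of ↥V) ⟦p⟧) ∧
      Function.Bijective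
        (FreeGroup.lift γ : FreeGroup {n : ℕ // 1 ≤ n} →* FundamentalGroup ↥V ⟨pt 0 0, h0⟩) := by
  exact ⟨γ, fun n => ⟨lpt n, lpt_range n, lpt_corners n, rfl⟩, lift_inj, lift_surj⟩
end

section
/- For every countable group G there exists a compact path connected subset K of ℝ⁴ whose fundamental group is isomorphic to G. -/
namespace PiOne

open Set Topology unitInterval

section Abstract
variable {X : Type*} [TopologicalSpace X]

theorem all_paths {ι : Type*} (U : ι → Set X) (ho : ∀ i, IsOpen (U i)) (hc : ∀ x, ∃ i, x ∈ U i)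
    (P : ∀ x y : X, Path.Homotopic.Quotient x y → Prop)
    (htr : ∀ x y z (γ : Path.Homotopic.Quotient x y) (γ' : Path.Homotopic.Quotient y z), P x y γ → P y z γ' → P x z (γ.trans γ'))
    (hloc : ∀ i x y (γ : Path x y), (∀ t, γ t ∈ U i) → P x y (.mk γ)) :
    ∀ x y (γ : Path.Homotopic.Quotient x y), P x y γ := by
  intro x y γ
  induction γ using Path.Homotopic.Quotient.ind with
  | mk γ =>
  obtain ⟨t, t0, tm, ⟨N, hN⟩, hcov⟩ := exists_monotone_Icc_subset_open_cover_unitInterval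
    (c := fun i => γ ⁻¹' U i) (fun i => (ho i).preimage γ.continuous)
    (fun s _ => by simpa using hc (γ s))
  have key : ∀ n, P _ _ (.mk (γ.subpath 0 (t n))) := by
    intro n
    induction n with
    | zero =>
      obtain ⟨i, hi⟩ := hc x
      rw [t0]
      apply hloc i
      simp [hi]
    | succ n ih =>
      obtain ⟨i, hi⟩ := hcov n
      have h2 : P _ _ (.mk (γ.subpath (t n) (t (n+1)))) := by
        apply hloc i
        intro s
        have : (γ.subpath (t n) (t (n+1))) s ∈ range (γ.subpath (t n) (t (n+1))) := ⟨s, rfl⟩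
        rw [Path.range_subpath_of_le _ _ _ (tm (Nat.le_succ n))] at this
        obtain ⟨r, hr, h⟩ := this
        rw [← h]
        exact hi hr
      have h3 := htr _ _ _ _ _ ih h2
      rw [← Path.Homotopic.Quotient.mk_trans] at h3
      rwa [Path.Homotopic.Quotient.eq.mpr ⟨Path.Homotopy.subpathTransSubpath γ 0 (t n) (t (n+1))⟩] at h3
  have h1 := key N
  rw [hN N le_rfl, Path.subpath_zero_one] at h1
  have : ∀ x' y' (hx : x' = x) (hy : y' = y), P x' y' (.mk (γ.cast hx hy)) → P x y (.mk γ) := by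
    rintro _ _ rfl rfl h; exact h
  exact this _ _ _ _ h1

/-- The class of a path inside a simply connected set. -/
noncomputable def cl (S : Set X) [SimplyConnectedSpace S] (x y : S) : Path.Homotopic.Quotient (x : X) (y : X) :=
  .mk ((PathConnectedSpace.somePath x y).map continuous_subtype_val)

theorem mk_eq_cl (S : Set X) [SimplyConnectedSpace S] {x y : X} (γ : Path x y)
    (h : ∀ t, γ t ∈ S) (hx : x ∈ S) (hy : y ∈ S) : .mk γ = cl S ⟨x, hx⟩ ⟨y, hy⟩ := by
  let γ' : Path (⟨x, hx⟩ : S) ⟨y, hy⟩ :=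
    { toFun := fun t => ⟨γ t, h t⟩
      continuous_toFun := by fun_prop
      source' := by simp
      target' := by simp }
  have h1 := SimplyConnectedSpace.paths_homotopic γ' (PathConnectedSpace.somePath _ _)
  have h2 := h1.map ⟨_, continuous_subtype_val⟩
  rw [cl, Path.Homotopic.Quotient.eq]
  exact h2

theorem exists_cl (S : Set X) [SimplyConnectedSpace S] (x y : S) :
    ∃ γ : Path (x : X) (y : X), (∀ t, γ t ∈ S) ∧ cl S x y = .mk γ :=
  ⟨_, fun _ => by simp, rfl⟩

theorem cl_trans (S : Set X) [SimplyConnectedSpace S] (x y z : S) :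
    (cl S x y).trans (cl S y z) = cl S x z := by
  rw [cl, cl, ← Path.Homotopic.Quotient.mk_trans]
  apply mk_eq_cl S _ _ x.2 z.2
  intro t
  rw [Path.trans_apply]
  split_ifs <;> simp

theorem cl_self (S : Set X) [SimplyConnectedSpace S] (x : S) : cl S x x = .refl _ := by
  rw [← Path.Homotopic.Quotient.mk_refl]
  exact (mk_eq_cl S _ (by simp) x.2 x.2).symm

theorem cl_symm (S : Set X) [SimplyConnectedSpace S] (x y : S) : (cl S x y).symm = cl S y x := by
  rw [cl, ← Path.Homotopic.Quotient.mk_symm]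
  exact mk_eq_cl S _ (by simp) y.2 x.2

theorem cl_eq (S T : Set X) [SimplyConnectedSpace S] [SimplyConnectedSpace T] {x y : X}
    (h : JoinedIn (S ∩ T) x y) (hxS : x ∈ S) (hyS : y ∈ S) (hxT : x ∈ T) (hyT : y ∈ T) :
    cl S ⟨x, hxS⟩ ⟨y, hyS⟩ = cl T ⟨x, hxT⟩ ⟨y, hyT⟩ := by
  obtain ⟨γ, hγ⟩ := h
  rw [← mk_eq_cl S γ (fun t => (hγ t).1), ← mk_eq_cl T γ (fun t => (hγ t).2)]

theorem gen {ι : Type*} (U : ι → Set X) (ho : ∀ i, IsOpen (U i)) (hc : ∀ x, ∃ i, x ∈ U i)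
    [∀ i, SimplyConnectedSpace (U i)] (b : X) (bs : ∀ i, U i) (m : ∀ i, Path.Homotopic.Quotient b (bs i))
    (H : Subgroup (FundamentalGroup X b))
    (hH : ∀ i j x (hi : x ∈ U i) (hj : x ∈ U j),
      FundamentalGroup.fromPath (((m i).trans (cl (U i) (bs i) ⟨x, hi⟩)).trans
        ((m j).trans (cl (U j) (bs j) ⟨x, hj⟩)).symm) ∈ H)
    (i0 : ι) (hb : b ∈ U i0) (hm : (m i0).trans (cl (U i0) (bs i0) ⟨b, hb⟩) = .refl b) :
    H = ⊤ := by
  have key := all_paths U ho hc (fun x y γ => ∀ i j (hi : x ∈ U i) (hj : y ∈ U j),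
      FundamentalGroup.fromPath ((((m i).trans (cl (U i) (bs i) ⟨x, hi⟩)).trans γ).trans
        ((m j).trans (cl (U j) (bs j) ⟨y, hj⟩)).symm) ∈ H) ?_ ?_
  · rw [eq_top_iff]
    intro γ _
    have := key b b γ i0 i0 hb hb
    rw [hm] at this
    have h2 : (Path.Homotopic.Quotient.refl b).symm = .refl b := by
      rw [← Path.Homotopic.Quotient.mk_refl, ← Path.Homotopic.Quotient.mk_symm, Path.refl_symm]
    rw [h2] at this
    simpa using this
  · intro x y z γ γ' h1 h2 i j hi hj
    obtain ⟨k, hk⟩ := hc y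
    have := H.mul_mem (h2 k j hk hj) (h1 i k hi hk)
    rw [FundamentalGroup.mul_def] at this
    convert this using 1
    generalize (m i).trans (cl (U i) (bs i) ⟨x, hi⟩) = A
    generalize (m j).trans (cl (U j) (bs j) ⟨z, hj⟩) = B
    generalize (m k).trans (cl (U k) (bs k) ⟨y, hk⟩) = C
    have : C.symm.trans (C.trans (γ'.trans B.symm)) = γ'.trans B.symm := by
      rw [← Path.Homotopic.Quotient.trans_assoc]; simp
    simp [FundamentalGroup.fromPath, FundamentalGroup.fromArrow, this]
  · intro k x y γ hγ i j hi hj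
    have hx : x ∈ U k := by simpa using hγ 0
    have hy : y ∈ U k := by simpa using hγ 1
    rw [mk_eq_cl (U k) γ hγ hx hy]
    have := H.mul_mem (hH k j y hy hj) (hH i k x hi hx)
    rw [FundamentalGroup.mul_def] at this
    convert this using 1
    rw [← cl_trans (U k) (bs k) ⟨x, hx⟩ ⟨y, hy⟩]
    generalize cl (U k) ⟨x, hx⟩ ⟨y, hy⟩ = γ'
    generalize (m i).trans (cl (U i) (bs i) ⟨x, hi⟩) = A
    generalize (m j).trans (cl (U j) (bs j) ⟨y, hj⟩) = B
    rw [← Path.Homotopic.Quotient.trans_assoc (m k)]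
    generalize (m k).trans (cl (U k) (bs k) ⟨x, hx⟩) = C
    have : C.symm.trans (C.trans (γ'.trans B.symm)) = γ'.trans B.symm := by
      rw [← Path.Homotopic.Quotient.trans_assoc]; simp
    simp [FundamentalGroup.fromPath, FundamentalGroup.fromArrow, this]

theorem hol {ι : Type*} {G : Type*} [Group G] (U : ι → Set X) (ho : ∀ i, IsOpen (U i))
    (hc : ∀ x, ∃ i, x ∈ U i) (sg : ι → X → G)
    (hsg : ∀ i j, ∀ x ∈ U i ∩ U j, ∀ᶠ y in 𝓝 x, y ∈ U i ∩ U j →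
      (sg j y)⁻¹ * sg i y = (sg j x)⁻¹ * sg i x) :
    ∃ T : ∀ x y : X, Path.Homotopic.Quotient x y → G → G,
      (∀ x y z (γ : Path.Homotopic.Quotient x y) (γ' : Path.Homotopic.Quotient y z) v, T x z (γ.trans γ') v = T y z γ' (T x y γ v)) ∧
      (∀ i x y (γ : Path x y), (∀ t, γ t ∈ U i) → ∀ v, T x y (.mk γ) v = sg i y * (sg i x)⁻¹ * v) := by
  let _ : TopologicalSpace G := ⊥
  have : DiscreteTopology G := ⟨rfl⟩
  choose idx hidx using hc
  let Z : FiberBundleCore ι X G :=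
    { baseSet := U
      isOpen_baseSet := ho
      indexAt := idx
      mem_baseSet_at := hidx
      coordChange := fun i j x v => (sg j x)⁻¹ * sg i x * v
      coordChange_self := by simp
      continuousOn_coordChange := by
        intro i j
        have h1 : ContinuousOn (fun x => (sg j x)⁻¹ * sg i x) (U i ∩ U j) := by
          intro x hx
          refine ContinuousWithinAt.congr_of_eventuallyEq
            (f := fun _ => (sg j x)⁻¹ * sg i x) continuousWithinAt_const ?_ rfl
          rw [Filter.EventuallyEq, eventually_nhdsWithin_iff]
          exact hsg i j x hx
        have h2 : ContinuousOn (fun p : X × G => (sg j p.1)⁻¹ * sg i p.1) ((U i ∩ U j) ×ˢ univ) :=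
          h1.comp continuousOn_fst (fun p hp => hp.1)
        exact h2.mul continuousOn_snd
      coordChange_comp := by
        intro i j k x _ v
        group }
  have cov : IsCoveringMap (Bundle.TotalSpace.proj : Bundle.TotalSpace G Z.Fiber → X) :=
    FiberBundle.isCoveringMap
  let Φ : Bundle.TotalSpace G Z.Fiber → G := fun e => sg (idx e.1) e.1 * (show G from e.2)
  let mkE : ∀ x, G → (Bundle.TotalSpace.proj : Bundle.TotalSpace G Z.Fiber → X) ⁻¹' {x} :=
    fun x v => ⟨⟨x, (show G from (sg (idx x) x)⁻¹ * v)⟩, rfl⟩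
  have hmk : ∀ x e, mkE x (Φ e.1) = e := by
    rintro x ⟨⟨y, v⟩, h⟩
    have : y = x := h
    subst this
    apply Subtype.ext
    simp only [mkE, Φ]
    congr 1
    exact inv_mul_cancel_left (G := G) _ _
  have hmk2 : ∀ x v, Φ (mkE x v).1 = v := by
    intro x v
    exact mul_inv_cancel_left (G := G) _ _
  refine ⟨fun x y γ v => Φ (cov.monodromy γ (mkE x v)).1, ?_, ?_⟩
  · intro x y z γ γ' v
    show Φ (cov.monodromy (γ.trans γ') (mkE x v)).1
      = Φ (cov.monodromy γ' (mkE y (Φ (cov.monodromy γ (mkE x v)).1))).1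
    rw [cov.monodromy_trans_apply, hmk]
  · intro i x y γ hγ v
    have hx : x ∈ U i := by simpa using hγ 0
    have hy : y ∈ U i := by simpa using hγ 1
    let Γ := cov.liftPath γ (mkE x v).1 (γ.source.trans (mkE x v).2.symm)
    have hΓ : ∀ t, (Γ t).proj = γ t := fun t => congr_fun (cov.liftPath_lifts γ _ _) t
    have hΓ0 : Γ 0 = (mkE x v).1 := cov.liftPath_zero _ _ _
    have hc : Continuous (fun t => (Z.localTriv i (Γ t)).2) := by
      refine continuous_snd.comp ?_
      rw [← continuousOn_univ]
      refine (Z.localTriv i).continuousOn.comp Γ.continuous.continuousOn ?_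
      intro t _
      rw [Bundle.Trivialization.mem_source]
      show (Γ t).proj ∈ U i
      rw [hΓ]; exact hγ t
    have h01 := PreconnectedSpace.constant inferInstance hc (x := 0) (y := 1)
    have hval : ∀ t, (Z.localTriv i (Γ t)).2 = (sg i (γ t))⁻¹ * Φ (Γ t) := by
      intro t
      rw [← hΓ t]
      exact mul_assoc (G := G) _ _ _
    rw [hval, hval, hΓ0, hmk2] at h01
    simp only [Path.source, Path.target] at h01
    show Φ (Γ 1) = _
    rw [mul_assoc, h01, mul_inv_cancel_left]
end Abstract
end PiOne

namespace PiOne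

open Set Topology unitInterval

section AbstractC
variable {X : Type*} [TopologicalSpace X]

theorem q_trans_symm {x y w : X} (A : Path.Homotopic.Quotient x y) (B : Path.Homotopic.Quotient y w) :
    (A.trans B).symm = B.symm.trans A.symm := by
  induction A using Path.Homotopic.Quotient.ind with
  | mk A =>
  induction B using Path.Homotopic.Quotient.ind with
  | mk B =>
  rw [← Path.Homotopic.Quotient.mk_trans, ← Path.Homotopic.Quotient.mk_symm, Path.trans_symm]
  simp

theorem q_symm_symm {x y : X} (A : Path.Homotopic.Quotient x y) : A.symm.symm = A := by
  induction A using Path.Homotopic.Quotient.ind with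
  | mk A =>
  rw [← Path.Homotopic.Quotient.mk_symm, ← Path.Homotopic.Quotient.mk_symm, Path.symm_symm]

theorem cl_back (S : Set X) [SimplyConnectedSpace S] {x y w : X} (hx : x ∈ S) (hy : y ∈ S)
    (B : Path.Homotopic.Quotient x w) :
    (cl S ⟨x, hx⟩ ⟨y, hy⟩).trans ((cl S ⟨y, hy⟩ ⟨x, hx⟩).trans B) = B := by
  rw [← Path.Homotopic.Quotient.trans_assoc, cl_trans, cl_self, Path.Homotopic.Quotient.refl_trans]

theorem slide (S T : Set X) [SimplyConnectedSpace S] [SimplyConnectedSpace T] {x y a b : X}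
    (h : JoinedIn (S ∩ T) x y) (haS : a ∈ S) (hbT : b ∈ T) :
    (cl S ⟨a, haS⟩ ⟨x, h.source_mem.1⟩).trans (cl T ⟨x, h.source_mem.2⟩ ⟨b, hbT⟩) =
    (cl S ⟨a, haS⟩ ⟨y, h.target_mem.1⟩).trans (cl T ⟨y, h.target_mem.2⟩ ⟨b, hbT⟩) := by
  rw [← cl_trans S ⟨a, haS⟩ ⟨x, h.source_mem.1⟩ ⟨y, h.target_mem.1⟩,
    cl_eq S T h h.source_mem.1 h.target_mem.1 h.source_mem.2 h.target_mem.2,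
    Path.Homotopic.Quotient.trans_assoc, cl_trans]

/-- The group element read off from two binary labels. -/
def kap {G : Type*} [Group G] (g h : G) (a b : Bool) : G :=
  (if a then g else 1)⁻¹ * (if b then g * h else g)

theorem pi_eq {G : Type*} [Group G] (U : Bool ⊕ (G × G) → Set X) (ho : ∀ i, IsOpen (U i))
    (hcov : ∀ x, ∃ i, x ∈ U i) [∀ i, SimplyConnectedSpace (U i)]
    (c : G → X) (hc : ∀ g e, c g ∈ U (.inl e))
    (z : G × G → Bool → Bool → X) 
    (h01 : ∀ p ∈ U (.inl false) ∩ U (.inl true), ∃ g, JoinedIn (U (.inl false) ∩ U (.inl true)) p (c g))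
    (hzc : ∀ w a b, JoinedIn (U (.inl false) ∩ U (.inl true)) (z w a b) (c (kap w.1 w.2 a b)))
    (hz0 : ∀ w a b, JoinedIn (U (.inl false) ∩ U (.inr w)) (z w a false) (z w a b))
    (hz1 : ∀ w a b, JoinedIn (U (.inl true) ∩ U (.inr w)) (z w false b) (z w a b))
    (h0w : ∀ w, ∀ p ∈ U (.inl false) ∩ U (.inr w), ∃ a,
      JoinedIn (U (.inl false) ∩ U (.inr w)) p (z w a false))
    (h1w : ∀ w, ∀ p ∈ U (.inl true) ∩ U (.inr w), ∃ b,
      JoinedIn (U (.inl true) ∩ U (.inr w)) p (z w false b))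
    (hww : ∀ w w' p, p ∈ U (.inr w) → p ∈ U (.inr w') → w = w')
    (sg : Bool ⊕ (G × G) → X → G) (hs0 : ∀ p, sg (.inl false) p = 1)
    (hs1 : ∀ g, sg (.inl true) (c g) = g)
    (hsg : ∀ i j, ∀ x ∈ U i ∩ U j, ∀ᶠ y in 𝓝 x, y ∈ U i ∩ U j →
      (sg j y)⁻¹ * sg i y = (sg j x)⁻¹ * sg i x) :
    Nonempty (FundamentalGroup X (c 1) ≃* G) := by
  let b : X := c 1
  have hb : ∀ e, b ∈ U (.inl e) := hc 1
  have hz0' : ∀ w a b, z w a b ∈ U (.inl false) := fun w a b => (hzc w a b).source_mem.1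
  have hz1' : ∀ w a b, z w a b ∈ U (.inl true) := fun w a b => (hzc w a b).source_mem.2
  have hzw' : ∀ w a b, z w a b ∈ U (.inr w) := fun w a b => (hz0 w a b).target_mem.2
  let r : G → Path.Homotopic.Quotient b b := fun g =>
    (cl (U (.inl false)) ⟨b, hb _⟩ ⟨c g, hc _ _⟩).trans (cl (U (.inl true)) ⟨c g, hc _ _⟩ ⟨b, hb _⟩)
  have r1 : r 1 = .refl b := by
    simp only [r]
    rw [cl_self, cl_self, Path.Homotopic.Quotient.refl_trans]
  -- p and q
  let P : ∀ (w : G × G), Bool → Path.Homotopic.Quotient b (z w false false) := fun w a =>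
    (cl (U (.inl false)) ⟨b, hb _⟩ ⟨z w a false, hz0' _ _ _⟩).trans
      (cl (U (.inr w)) ⟨z w a false, hzw' _ _ _⟩ ⟨z w false false, hzw' _ _ _⟩)
  let Q : ∀ (w : G × G), Bool → Path.Homotopic.Quotient b (z w false false) := fun w e =>
    (cl (U (.inl true)) ⟨b, hb _⟩ ⟨z w false e, hz1' _ _ _⟩).trans
      (cl (U (.inr w)) ⟨z w false e, hzw' _ _ _⟩ ⟨z w false false, hzw' _ _ _⟩)
  have key : ∀ w a e, P w a = (r (kap w.1 w.2 a e)).trans (Q w e) := by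
    intro w a e
    simp only [P, Q, r]
    rw [slide _ _ (hz0 w a e), slide _ _ (hz1 w a e), ← slide _ _ (hzc w a e)]
    rw [Path.Homotopic.Quotient.trans_assoc, cl_back]
  have rinj : Function.Injective r := by
    obtain ⟨T, hT, hT2⟩ := hol U ho hcov sg hsg
    have hTc : ∀ i x y (hx : x ∈ U i) (hy : y ∈ U i) v, T x y (cl (U i) ⟨x, hx⟩ ⟨y, hy⟩) v = sg i y * (sg i x)⁻¹ * v := by
      intro i x y hx hy v
      obtain ⟨γ, h1, h2⟩ := exists_cl (U i) ⟨x, hx⟩ ⟨y, hy⟩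
      rw [h2, hT2 i _ _ γ h1]
    have : ∀ g, T b b (r g) 1 = g⁻¹ := by
      intro g
      simp only [r]
      rw [hT, hTc, hTc]
      simp [hs0, hs1, b]
    intro g h hgh
    have h1 := this g
    rw [hgh, this h] at h1
    exact (inv_injective h1).symm
  -- group-level versions
  have cancel : ∀ {x y w : X} (A : Path.Homotopic.Quotient x y) (B : Path.Homotopic.Quotient y w), (A.trans B).trans B.symm = A := by
    intro x y w A B; rw [Path.Homotopic.Quotient.trans_assoc]; simp
  have cancel' : ∀ {x y w : X} (A : Path.Homotopic.Quotient x y) (B : Path.Homotopic.Quotient x w), A.trans (A.symm.trans B) = B := by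
    intro x y w A B; rw [← Path.Homotopic.Quotient.trans_assoc]; simp
  have cancel'' : ∀ {x y w : X} (A : Path.Homotopic.Quotient y x) (B : Path.Homotopic.Quotient x w), A.symm.trans (A.trans B) = B := by
    intro x y w A B; rw [← Path.Homotopic.Quotient.trans_assoc]; simp
  have hr : ∀ w a e, r (kap w.1 w.2 a e) = (P w a).trans (Q w e).symm := by
    intro w a e; rw [key w a e, cancel]
  have rmul : ∀ g h, (r g).trans (r h) = r (g * h) := by
    intro g h
    have e00 := hr (g, h) false false
    have e10 := hr (g, h) true false
    have e11 := hr (g, h) true true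
    have e01 := hr (g, h) false true
    simp only [kap] at e00 e10 e11 e01
    simp at e00 e10 e11 e01
    rw [r1] at e10
    have e3 : P (g, h) true = Q (g, h) false := by
      have := congrArg (fun t => Path.Homotopic.Quotient.trans t (Q (g, h) false)) e10
      simpa [Path.Homotopic.Quotient.trans_assoc] using this.symm
    rw [e00, e11, e01, e3, Path.Homotopic.Quotient.trans_assoc, cancel'']
  let φ : G →* FundamentalGroup X b :=
    { toFun := fun g => FundamentalGroup.fromPath (r g⁻¹)
      map_one' := by
        rw [inv_one, r1]; rfl
      map_mul' := by
        intro g h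
        rw [FundamentalGroup.mul_def, mul_inv_rev, ← rmul] }
  have φinj : Function.Injective φ := by
    intro g h hgh
    exact inv_injective (rinj hgh)
  have rmem : ∀ g, FundamentalGroup.fromPath (r g) ∈ φ.range := fun g => ⟨g⁻¹, by
    show FundamentalGroup.fromPath (r g⁻¹⁻¹) = _
    rw [inv_inv]⟩
  have rinv : ∀ γ : Path.Homotopic.Quotient b b, FundamentalGroup.fromPath γ ∈ φ.range →
      FundamentalGroup.fromPath γ.symm ∈ φ.range := by
    intro γ h
    exact φ.range.inv_mem h
  have φsurj : φ.range = ⊤ := by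
    let bs : ∀ i, U i := fun i => match i with
      | .inl e => ⟨b, hb e⟩
      | .inr w => ⟨z w false false, hzw' _ _ _⟩
    let m : ∀ i, Path.Homotopic.Quotient b (bs i) := fun i => match i with
      | .inl e => .refl b
      | .inr w => cl (U (.inl false)) ⟨b, hb _⟩ ⟨z w false false, hz0' _ _ _⟩
    have m0 : ∀ w, P w false = m (.inr w) := by
      intro w
      simp only [P, m]; rw [cl_self, Path.Homotopic.Quotient.trans_refl]
    have symm_of : ∀ i j x (hi : x ∈ U i) (hj : x ∈ U j),
      FundamentalGroup.fromPath (((m i).trans (cl (U i) (bs i) ⟨x, hi⟩)).trans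
        ((m j).trans (cl (U j) (bs j) ⟨x, hj⟩)).symm) ∈ φ.range → 
      FundamentalGroup.fromPath (((m j).trans (cl (U j) (bs j) ⟨x, hj⟩)).trans
        ((m i).trans (cl (U i) (bs i) ⟨x, hi⟩)).symm) ∈ φ.range := by
      intro i j x hi hj h
      have := rinv _ h
      rwa [q_trans_symm, q_symm_symm] at this
    have c01 : ∀ x (hi : x ∈ U (.inl false)) (hj : x ∈ U (.inl true)),
      FundamentalGroup.fromPath (((m (.inl false)).trans (cl (U (.inl false)) (bs (.inl false)) ⟨x, hi⟩)).trans
        ((m (.inl true)).trans (cl (U (.inl true)) (bs (.inl true)) ⟨x, hj⟩)).symm) ∈ φ.range := by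
      intro x hi hj
      obtain ⟨g, hg⟩ := h01 x ⟨hi, hj⟩
      have := rmem g
      simp only [r] at this
      rw [← slide _ _ hg] at this
      simp only [m, bs]
      rwa [Path.Homotopic.Quotient.refl_trans, Path.Homotopic.Quotient.refl_trans, cl_symm]
    have c0w : ∀ w x (hi : x ∈ U (.inl false)) (hj : x ∈ U (.inr w)),
      FundamentalGroup.fromPath (((m (.inl false)).trans (cl (U (.inl false)) (bs (.inl false)) ⟨x, hi⟩)).trans
        ((m (.inr w)).trans (cl (U (.inr w)) (bs (.inr w)) ⟨x, hj⟩)).symm) ∈ φ.range := by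
      intro w x hi hj
      obtain ⟨a, ha⟩ := h0w w x ⟨hi, hj⟩
      have e : ((m (.inl false)).trans (cl (U (.inl false)) (bs (.inl false)) ⟨x, hi⟩)).trans
          ((m (.inr w)).trans (cl (U (.inr w)) (bs (.inr w)) ⟨x, hj⟩)).symm
          = (P w a).trans (P w false).symm := by
        rw [m0, q_trans_symm, ← Path.Homotopic.Quotient.trans_assoc, cl_symm]
        simp only [m, bs]
        rw [Path.Homotopic.Quotient.refl_trans, slide _ _ ha]
      rw [e, key w a false, key w false false, q_trans_symm, Path.Homotopic.Quotient.trans_assoc,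
        cancel']
      exact φ.range.mul_mem (rinv _ (rmem _)) (rmem _)
    have c1w : ∀ w x (hi : x ∈ U (.inl true)) (hj : x ∈ U (.inr w)),
      FundamentalGroup.fromPath (((m (.inl true)).trans (cl (U (.inl true)) (bs (.inl true)) ⟨x, hi⟩)).trans
        ((m (.inr w)).trans (cl (U (.inr w)) (bs (.inr w)) ⟨x, hj⟩)).symm) ∈ φ.range := by
      intro w x hi hj
      obtain ⟨a, ha⟩ := h1w w x ⟨hi, hj⟩
      have e : ((m (.inl true)).trans (cl (U (.inl true)) (bs (.inl true)) ⟨x, hi⟩)).trans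
          ((m (.inr w)).trans (cl (U (.inr w)) (bs (.inr w)) ⟨x, hj⟩)).symm
          = (Q w a).trans (P w false).symm := by
        rw [m0, q_trans_symm, ← Path.Homotopic.Quotient.trans_assoc, cl_symm]
        simp only [m, bs]
        rw [Path.Homotopic.Quotient.refl_trans, slide _ _ ha]
      rw [e, key w false a, q_trans_symm, cancel']
      exact rinv _ (rmem _)
    have cs : ∀ i x (hi : x ∈ U i),
      FundamentalGroup.fromPath (((m i).trans (cl (U i) (bs i) ⟨x, hi⟩)).trans
        ((m i).trans (cl (U i) (bs i) ⟨x, hi⟩)).symm) ∈ φ.range := by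
      intro i x hi
      rw [Path.Homotopic.Quotient.trans_symm, ← r1]
      exact rmem 1
    refine gen U ho hcov b bs m φ.range ?_ (.inl false) (hb _) ?_
    · rintro ((_ | _) | w) ((_ | _) | w') x hi hj
      · exact cs _ _ hi
      · exact c01 _ hi hj
      · exact c0w _ _ hi hj
      · exact symm_of _ _ _ _ _ (c01 _ hj hi)
      · exact cs _ _ hi
      · exact c1w _ _ hi hj
      · exact symm_of _ _ _ _ _ (c0w _ _ hj hi)
      · exact symm_of _ _ _ _ _ (c1w _ _ hj hi)
      · obtain rfl := hww _ _ _ hi hj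
        exact cs _ _ hi
    · simp only [m, bs]
      rw [cl_self, Path.Homotopic.Quotient.refl_trans]
  exact ⟨(MulEquiv.ofBijective φ ⟨φinj, MonoidHom.range_eq_top.1 φsurj⟩).symm⟩
end AbstractC
end PiOne

namespace PiOne

open Set Topology unitInterval

section Topo

theorem joined_sub {E : Type*} [TopologicalSpace E] {S O : Set E} {p q : S}
    (h : JoinedIn (S ∩ O) (p : E) q) : JoinedIn ((Subtype.val : S → E) ⁻¹' O) p q := by
  obtain ⟨γ, hγ⟩ := h
  refine ⟨⟨⟨fun t => ⟨γ t, (hγ t).1⟩, by fun_prop⟩, ?_, ?_⟩, fun t => (hγ t).2⟩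
  · apply Subtype.ext; simp
  · apply Subtype.ext; simp

theorem contr_step {E : Type*} [AddCommGroup E] [Module ℝ E] [TopologicalSpace E]
    [ContinuousAdd E] [ContinuousSMul ℝ E] (S T : Set E) (f : E → E) (hf : Continuous f)
    (hTS : T ⊆ S) (hfT : ∀ p ∈ S, f p ∈ T) (hid : ∀ p ∈ T, f p = p)
    (hseg : ∀ p ∈ S, ∀ r : ℝ, 0 ≤ r → r ≤ 1 → (1 - r) • p + r • f p ∈ S)
    [ContractibleSpace T] : ContractibleSpace S := by
  let F : C(S, T) := ⟨fun p => ⟨f p, hfT p p.2⟩, by fun_prop⟩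
  let J : C(T, S) := ⟨fun p => ⟨p, hTS p.2⟩, by fun_prop⟩
  have e : ContinuousMap.HomotopyEquiv S T :=
    { toFun := F
      invFun := J
      left_inv := by
        symm
        refine ⟨⟨⟨fun q => ⟨(1 - (q.1 : ℝ)) • (q.2 : E) + (q.1 : ℝ) • f q.2, 
          hseg _ q.2.2 _ q.1.2.1 q.1.2.2⟩, ?_⟩, ?_, ?_⟩⟩
        · fun_prop
        · intro x; apply Subtype.ext; simp
        · intro x; apply Subtype.ext; simp [F, J]
      right_inv := by
        have : F.comp J = ContinuousMap.id T := by
          ext x; exact hid x x.2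
        rw [this] }
  exact e.contractibleSpace

theorem contr_sub {E : Type*} [TopologicalSpace E] (S O : Set E) [ContractibleSpace ↥(S ∩ O)] :
    SimplyConnectedSpace ↥((Subtype.val : S → E) ⁻¹' O) := by
  let e : ↥((Subtype.val : S → E) ⁻¹' O) ≃ₜ ↥(S ∩ O) :=
    { toFun := fun p => ⟨p.1.1, p.1.2, p.2⟩
      invFun := fun p => ⟨⟨p.1, p.2.1⟩, p.2.2⟩
      left_inv := fun _ => rfl
      right_inv := fun _ => rfl
      continuous_toFun := by fun_prop
      continuous_invFun := by fun_prop }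
  have := e.contractibleSpace
  infer_instance

theorem closed_union {E ι : Type*} [TopologicalSpace E] (t : E → ℝ) (ht : Continuous t)
    (n : ι → ℕ) (hn : Function.Injective n) (S : ι → Set E) (hS : ∀ i, IsClosed (S i))
    (h : ∀ i, ∀ p ∈ S i, (n i : ℝ) ≤ t p) : IsClosed {p | ∃ i, p ∈ S i} := by
  have : {p | ∃ i, p ∈ S i} = ⋃ i, S i := by ext; simp
  rw [this]
  apply LocallyFinite.isClosed_iUnion _ hS
  intro p
  refine ⟨{q | t q < t p + 1}, (isOpen_lt ht continuous_const).mem_nhds (by simp), ?_⟩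
  obtain ⟨M, hM⟩ := exists_nat_gt (t p + 1)
  refine ((Set.finite_lt_nat M).preimage hn.injOn).subset ?_
  rintro i ⟨q, hq, hq2⟩
  have := h i q hq
  have h3 : (n i : ℝ) < M := by
    have : t q < t p + 1 := hq2
    linarith
  exact_mod_cast h3
end Topo
end PiOne

namespace PiOne

open Set Topology unitInterval

section Geo
set_option linter.unusedSectionVars false
variable {G : Type} [Group G] (m : G → ℕ) (N : G × G → ℕ)

/-- Numerical value of a bit. -/
def bi (a : Bool) : ℝ := if a then 1 else 0

/-- The ambient box. -/
def Box (p : ℝ × ℝ × ℝ × ℝ) : Prop :=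
  0 ≤ p.1 ∧ 0 ≤ p.2.1 ∧ p.2.1 ≤ 1 ∧ 0 ≤ p.2.2.1 ∧ p.2.2.1 ≤ 4 * p.1 + 4 ∧ 0 ≤ p.2.2.2 ∧ p.2.2.2 ≤ 1

/-- The tube belonging to a group element. -/
def Tube (g : G) (p : ℝ × ℝ × ℝ × ℝ) : Prop :=
  (m g : ℝ) ≤ p.1 ∧ 4 * (m g : ℝ) ≤ p.2.2.1 ∧ p.2.2.1 ≤ 4 * (m g : ℝ) + 3

/-- The base. -/
def Bas (p : ℝ × ℝ × ℝ × ℝ) : Prop := p.2.1 = 0 ∨ p.2.1 = 1 ∨ ∃ g, Tube m g p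

/-- A connecting segment. -/
def Sg (k : G × G) (a b : Bool) (p : ℝ × ℝ × ℝ × ℝ) : Prop :=
  p.2.2.1 = 4 * (m (kap k.1 k.2 a b) : ℝ) + (bi a + 2 * bi b) ∧
  p.1 = (N k : ℝ) + (bi a * (1 - p.2.1) + bi b * p.2.1) / 2

/-- Left branch. -/
def PP (k : G × G) (a : Bool) (p : ℝ × ℝ × ℝ × ℝ) : Prop :=
  (p.2.1 = 0 ∧ p.1 = N k + bi a / 2) ∨ ∃ b, Sg m N k a b p

/-- Right branch. -/
def RR (k : G × G) (b : Bool) (p : ℝ × ℝ × ℝ × ℝ) : Prop :=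
  (p.2.1 = 1 ∧ p.1 = N k + bi b / 2) ∨ ∃ a, Sg m N k a b p

/-- The attaching graph. -/
def DD (k : G × G) (p : ℝ × ℝ × ℝ × ℝ) : Prop := ∃ a, PP m N k a p ∨ RR m N k a p

/-- The cap. -/
def Cap (k : G × G) (p : ℝ × ℝ × ℝ × ℝ) : Prop :=
  p.2.2.2 = 1 ∧ (N k : ℝ) ≤ p.1 ∧ p.1 ≤ N k + 1 / 2

/-- The space. -/
def XS : Set (ℝ × ℝ × ℝ × ℝ) :=
  {p | Box p ∧ ((p.2.2.2 = 0 ∧ Bas m p) ∨ ∃ k, DD m N k p ∨ Cap N k p)}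

/-- The cover. -/
def OO : Bool ⊕ (G × G) → Set (ℝ × ℝ × ℝ × ℝ)
  | .inl false => {p | p.2.2.2 < 1 ∧ p.2.1 < 1}
  | .inl true => {p | p.2.2.2 < 1 ∧ 0 < p.2.1}
  | .inr k => {p | 0 < p.2.2.2 ∧ (N k : ℝ) - 1 / 4 < p.1 ∧ p.1 < N k + 3 / 4}

variable {m N}

theorem bi_cases (a : Bool) : bi a = 0 ∨ bi a = 1 := by cases a <;> simp [bi]

theorem bi_inj {a b : Bool} (h : bi a = bi b) : a = b := by
  cases a <;> cases b <;> simp [bi] at h ⊢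

theorem tube_unique (hm : Function.Injective m) {g g' : G} {y y' : ℝ}
    (h1 : 4 * (m g : ℝ) ≤ y) (h2 : y ≤ 4 * (m g : ℝ) + 3)
    (h1' : 4 * (m g' : ℝ) ≤ y') (h2' : y' ≤ 4 * (m g' : ℝ) + 3) (hyy : |y - y'| < 1) : g = g' := by
  rw [abs_lt] at hyy
  apply hm
  have a1 : (m g : ℝ) < m g' + 1 := by linarith
  have a2 : (m g' : ℝ) < m g + 1 := by linarith
  have a1 : m g < m g' + 1 := by exact_mod_cast a1
  have a2 : m g' < m g + 1 := by exact_mod_cast a2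
  omega

theorem DD_range {k : G × G} {p : ℝ × ℝ × ℝ × ℝ} (hB : Box p) (h : DD m N k p) :
    (N k : ℝ) ≤ p.1 ∧ p.1 ≤ N k + 1 / 2 := by
  obtain ⟨h0, h1, h2, -⟩ := hB
  obtain ⟨a, (⟨_, h⟩ | ⟨b, _, h⟩) | (⟨_, h⟩ | ⟨b, _, h⟩)⟩ := h <;> rw [h]
  · rcases bi_cases a with e | e <;> rw [e] <;> constructor <;> linarith
  · rcases bi_cases a with e | e <;> rcases bi_cases b with e' | e' <;> rw [e, e'] <;> constructor <;> linarith
  · rcases bi_cases a with e | e <;> rw [e] <;> constructor <;> linarith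
  · rcases bi_cases a with e | e <;> rcases bi_cases b with e' | e' <;> rw [e, e'] <;> constructor <;> linarith

theorem Sg_tube (hN : ∀ k a b, m (kap k.1 k.2 a b) ≤ N k) {k : G × G} {a b : Bool}
    {p : ℝ × ℝ × ℝ × ℝ} (hB : Box p) (h : Sg m N k a b p) : Tube m (kap k.1 k.2 a b) p := by
  have h1 := (DD_range (m := m) hB ⟨a, Or.inl (Or.inr ⟨b, h⟩)⟩).1
  have h2 : (m (kap k.1 k.2 a b) : ℝ) ≤ N k := by exact_mod_cast hN k a b
  refine ⟨by linarith, ?_, ?_⟩ <;> rw [h.1] <;> rcases bi_cases a with e | e <;>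
    rcases bi_cases b with e' | e' <;> rw [e, e'] <;> linarith

theorem DD_bas (hN : ∀ k a b, m (kap k.1 k.2 a b) ≤ N k) {k : G × G} {p : ℝ × ℝ × ℝ × ℝ} (hB : Box p)
    (h : DD m N k p) : Bas m p := by
  obtain ⟨a, (⟨h, _⟩ | ⟨b, h⟩) | (⟨h, _⟩ | ⟨b, h⟩)⟩ := h
  · exact Or.inl h
  · exact Or.inr (Or.inr ⟨_, Sg_tube hN hB h⟩)
  · exact Or.inr (Or.inl h)
  · exact Or.inr (Or.inr ⟨_, Sg_tube hN hB h⟩)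

theorem N_unique (hNi : Function.Injective N) {k k' : G × G} {t : ℝ}
    (h1 : (N k : ℝ) - 1 / 4 < t) (h2 : t < N k + 3 / 4) (h1' : (N k' : ℝ) - 1 / 4 < t)
    (h2' : t < N k' + 3 / 4) : k = k' := by
  apply hNi
  have a1 : (N k : ℝ) < N k' + 1 := by linarith
  have a2 : (N k' : ℝ) < N k + 1 := by linarith
  have a1 : N k < N k' + 1 := by exact_mod_cast a1
  have a2 : N k' < N k + 1 := by exact_mod_cast a2
  omega

/-- In the base part every point lies in the base region. -/
theorem low_bas (hN : ∀ k a b, m (kap k.1 k.2 a b) ≤ N k) {p : ℝ × ℝ × ℝ × ℝ} (hp : p ∈ XS m N)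
    (hw : p.2.2.2 < 1) : Bas m p := by
  obtain ⟨hB, ⟨_, h⟩ | ⟨k, h | h⟩⟩ := hp
  · exact h
  · exact DD_bas hN hB h
  · exact absurd h.1 hw.ne

theorem mid_DD (hNi : Function.Injective N) {p : ℝ × ℝ × ℝ × ℝ} {k : G × G} (hp : p ∈ XS m N)
    (hw : p.2.2.2 < 1) (hk : p ∈ OO N (.inr k)) : DD m N k p := by
  obtain ⟨hB, ⟨h, _⟩ | ⟨k', h | h⟩⟩ := hp
  · exact absurd h hk.1.ne'
  · have h2 := DD_range hB h
    obtain ⟨_, hk1, hk2⟩ := hk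
    rwa [N_unique hNi (k' := k') hk1 hk2 (by linarith) (by linarith)]
  · exact absurd h.1 hw.ne

theorem PP_unique (hm : Function.Injective m) {k : G × G} {a a' : Bool}
    {p : ℝ × ℝ × ℝ × ℝ}
    (h : PP m N k a p) (h' : PP m N k a' p) : a = a' := by
  apply bi_inj
  have H : ∀ {a}, PP m N k a p → p.2.1 = 0 → p.1 = N k + bi a / 2 := by
    rintro a (h | ⟨b, h⟩) h0
    · exact h.2
    · rw [h.2, h0]; ring
  by_cases h0 : p.2.1 = 0
  · have := H h h0
    have := H h' h0
    linarith
  · obtain ⟨b, h⟩ := h.resolve_left (fun h => h0 h.1)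
    obtain ⟨b', h'⟩ := h'.resolve_left (fun h => h0 h.1)
    have := h.1.symm.trans h'.1
    have e : kap k.1 k.2 a b = kap k.1 k.2 a' b' := by
      refine tube_unique hm (y := p.2.2.1) (y' := p.2.2.1) ?_ ?_ ?_ ?_ (by simp)
      · rw [h.1]; rcases bi_cases a with e | e <;>
          rcases bi_cases b with e' | e' <;> rw [e, e'] <;> linarith
      · rw [h.1]; rcases bi_cases a with e | e <;>
          rcases bi_cases b with e' | e' <;> rw [e, e'] <;> linarith
      · rw [h'.1]; rcases bi_cases a' with e | e <;>
          rcases bi_cases b' with e' | e' <;> rw [e, e'] <;> linarith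
      · rw [h'.1]; rcases bi_cases a' with e | e <;>
          rcases bi_cases b' with e' | e' <;> rw [e, e'] <;> linarith
    rw [e] at this
    rcases bi_cases a with e | e <;> rcases bi_cases b with e' | e' <;>
    rcases bi_cases a' with e2 | e2 <;> rcases bi_cases b' with e2' | e2' <;>
    rw [e, e', e2, e2'] at this <;> rw [e, e2] <;> linarith

theorem RR_unique (hm : Function.Injective m) {k : G × G} {a a' : Bool}
    {p : ℝ × ℝ × ℝ × ℝ}
    (h : RR m N k a p) (h' : RR m N k a' p) : a = a' := by
  apply bi_inj
  have H : ∀ {a}, RR m N k a p → p.2.1 = 1 → p.1 = N k + bi a / 2 := by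
    rintro a (h | ⟨b, h⟩) h0
    · exact h.2
    · rw [h.2, h0]; ring
  by_cases h0 : p.2.1 = 1
  · have := H h h0
    have := H h' h0
    linarith
  · obtain ⟨b, h⟩ := h.resolve_left (fun h => h0 h.1)
    obtain ⟨b', h'⟩ := h'.resolve_left (fun h => h0 h.1)
    have := h.1.symm.trans h'.1
    have e : kap k.1 k.2 b a = kap k.1 k.2 b' a' := by
      refine tube_unique hm (y := p.2.2.1) (y' := p.2.2.1) ?_ ?_ ?_ ?_ (by simp)
      · rw [h.1]; rcases bi_cases a with e | e <;>
          rcases bi_cases b with e' | e' <;> rw [e, e'] <;> linarith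
      · rw [h.1]; rcases bi_cases a with e | e <;>
          rcases bi_cases b with e' | e' <;> rw [e, e'] <;> linarith
      · rw [h'.1]; rcases bi_cases a' with e | e <;>
          rcases bi_cases b' with e' | e' <;> rw [e, e'] <;> linarith
      · rw [h'.1]; rcases bi_cases a' with e | e <;>
          rcases bi_cases b' with e' | e' <;> rw [e, e'] <;> linarith
    rw [e] at this
    rcases bi_cases a with e | e <;> rcases bi_cases b with e' | e' <;>
    rcases bi_cases a' with e2 | e2 <;> rcases bi_cases b' with e2' | e2' <;>
    rw [e, e', e2, e2'] at this <;> rw [e, e2] <;> linarith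

/-! Closedness -/
theorem closed_Box : IsClosed {p | Box p} := by
  unfold Box
  simp only [ofPred_and]
  repeat' apply IsClosed.inter
  all_goals exact isClosed_le (by fun_prop) (by fun_prop)

theorem closed_Sg (k : G × G) (a b : Bool) : IsClosed {p | Sg m N k a b p} := by
  unfold Sg
  simp only [ofPred_and]
  apply IsClosed.inter <;> exact isClosed_eq (by fun_prop) (by fun_prop)

theorem closed_PP (k : G × G) (a : Bool) : IsClosed {p | PP m N k a p} := by
  unfold PP
  simp only [Bool.exists_bool, ofPred_or, ofPred_and]
  refine IsClosed.union (IsClosed.inter ?_ ?_) ((closed_Sg _ _ _).union (closed_Sg _ _ _)) <;>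
  exact isClosed_eq (by fun_prop) (by fun_prop)

theorem closed_RR (k : G × G) (a : Bool) : IsClosed {p | RR m N k a p} := by
  unfold RR
  simp only [Bool.exists_bool, ofPred_or, ofPred_and]
  refine IsClosed.union (IsClosed.inter ?_ ?_) ((closed_Sg _ _ _).union (closed_Sg _ _ _)) <;>
  exact isClosed_eq (by fun_prop) (by fun_prop)

theorem closed_XS (hm : Function.Injective m) (hNi : Function.Injective N) : IsClosed (XS m N) := by
  have h1 : IsClosed {p | ∃ g, p ∈ {p | Tube m g p}} := by
    apply closed_union Prod.fst continuous_fst m hm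
    · intro g
      unfold Tube
      simp only [ofPred_and]
      repeat' apply IsClosed.inter
      all_goals exact isClosed_le (by fun_prop) (by fun_prop)
    · rintro g p ⟨h, _⟩; exact h
  have h2 : IsClosed {p | ∃ k, p ∈ {p | Box p ∧ (DD m N k p ∨ Cap N k p)}} := by
    apply closed_union Prod.fst continuous_fst N hNi
    · intro k
      simp only [DD, Cap, Bool.exists_bool, ofPred_or, ofPred_and]
      refine closed_Box.inter (IsClosed.union ?_ ?_)
      · exact ((closed_PP _ _).union (closed_RR _ _)).union ((closed_PP _ _).union (closed_RR _ _))
      · exact (isClosed_eq (by fun_prop) (by fun_prop)).inter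
          ((isClosed_le (by fun_prop) (by fun_prop)).inter (isClosed_le (by fun_prop) (by fun_prop)))
    · rintro k p ⟨hB, h | h⟩
      · exact (DD_range hB h).1
      · exact h.2.1
  have : XS m N = ({p | Box p} ∩ ({p | p.2.2.2 = 0} ∩ ({p | p.2.1 = 0} ∪ ({p | p.2.1 = 1} ∪ {p | ∃ g, p ∈ {p | Tube m g p}}))))
      ∪ {p | ∃ k, p ∈ {p | Box p ∧ (DD m N k p ∨ Cap N k p)}} := by
    ext p
    simp only [XS, Bas, mem_ofPred_eq, mem_union, mem_inter_iff, exists_and_left]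
    exact and_or_left
  rw [this]
  exact (closed_Box.inter ((isClosed_eq (by fun_prop) (by fun_prop)).inter
    ((isClosed_eq (by fun_prop) (by fun_prop)).union
      ((isClosed_eq (by fun_prop) (by fun_prop)).union h1)))).union h2

end Geo
end PiOne

namespace PiOne

open Set Topology unitInterval

section Geo
set_option linter.unusedSectionVars false
variable {G : Type} [Group G] {m : G → ℕ} {N : G × G → ℕ}

theorem DD_w {k : G × G} {t x y w w' : ℝ} (h : DD m N k (t, x, y, w)) : DD m N k (t, x, y, w') := h
theorem Bas_w {t x y w w' : ℝ} (h : Bas m (t, x, y, w)) : Bas m (t, x, y, w') := h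

theorem mix_le {a b c r : ℝ} (h0 : 0 ≤ r) (h1 : r ≤ 1) (ha : a ≤ c) (hb : b ≤ c) :
    (1 - r) * a + r * b ≤ c := by nlinarith
theorem le_mix {a b c r : ℝ} (h0 : 0 ≤ r) (h1 : r ≤ 1) (ha : c ≤ a) (hb : c ≤ b) :
    c ≤ (1 - r) * a + r * b := by nlinarith

theorem XS_low {t x y w : ℝ} (hN : ∀ k a b, m (kap k.1 k.2 a b) ≤ N k)
    (h : (t, x, y, w) ∈ XS m N) (hw : w < 1) {w' : ℝ} (h0 : 0 ≤ w') (h1 : w' ≤ w) :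
    (t, x, y, w') ∈ XS m N := by
  obtain ⟨⟨b1, b2, b3, b4, b5, b6, b7⟩, ⟨hh, h⟩ | ⟨k, h | h⟩⟩ := h
  · simp only at hh
    exact ⟨⟨b1, b2, b3, b4, b5, h0, h1.trans b7⟩, .inl ⟨by simp only; linarith, h⟩⟩
  · exact ⟨⟨b1, b2, b3, b4, b5, h0, h1.trans b7⟩, .inr ⟨k, .inl h⟩⟩
  · exact absurd h.1 hw.ne

theorem contr_false (hN : ∀ k a b, m (kap k.1 k.2 a b) ≤ N k) :
    ContractibleSpace ↥(XS m N ∩ OO N (.inl false)) := by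
  let T2 : Set (ℝ × ℝ × ℝ × ℝ) := {p | p.2.2.2 = 0 ∧ p.2.1 = 0 ∧ 0 ≤ p.1 ∧ 0 ≤ p.2.2.1 ∧ p.2.2.1 ≤ 4 * p.1 + 4}
  have c2 : ContractibleSpace T2 := by
    apply Convex.contractibleSpace
    · rintro ⟨t, x, y, w⟩ ⟨h1, h2, h3, h4, h5⟩ ⟨t', x', y', w'⟩ ⟨h1', h2', h3', h4', h5'⟩ a b ha hb hab
      simp only at h1 h2 h3 h4 h5 h1' h2' h3' h4' h5'
      refine ⟨?_, ?_, ?_, ?_, ?_⟩ <;> simp [h1, h1', h2, h2']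
      · positivity
      · positivity
      · nlinarith
    · exact ⟨(0, 0, 0, 0), by simp [T2]⟩
  let T1 : Set (ℝ × ℝ × ℝ × ℝ) := {p | p ∈ XS m N ∧ p.2.2.2 = 0 ∧ p.2.1 < 1}
  have c1 : ContractibleSpace T1 := by
    apply contr_step T1 T2 (fun p => (p.1, 0, p.2.2.1, 0)) (by fun_prop)
    · rintro ⟨t, x, y, w⟩ ⟨h1, h2, h3, h4, h5⟩
      simp only at h1 h2 h3 h4 h5
      subst h1 h2
      exact ⟨⟨⟨h3, le_rfl, zero_le_one, h4, h5, le_rfl, zero_le_one⟩, .inl ⟨rfl, .inl rfl⟩⟩, rfl,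
        zero_lt_one⟩
    · rintro ⟨t, x, y, w⟩ ⟨⟨⟨b1, b2, b3, b4, b5, b6, b7⟩, _⟩, _⟩
      exact ⟨rfl, rfl, b1, b4, b5⟩
    · rintro ⟨t, x, y, w⟩ ⟨h1, h2, h3, h4, h5⟩
      simp only at h1 h2 h3 h4 h5
      subst h1 h2; rfl
    · rintro ⟨t, x, y, w⟩ ⟨h, h1, h2⟩ r r0 r1
      have hb := low_bas hN h (by rw [h1]; exact zero_lt_one)
      obtain ⟨⟨b1, b2, b3, b4, b5, b6, b7⟩, _⟩ := h
      simp only at h1 h2 b1 b2 b3 b4 b5 b6 b7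
      subst h1
      have : (1 - r) • ((t, x, y, 0) : ℝ × ℝ × ℝ × ℝ) + r • (t, 0, y, 0) = (t, (1 - r) * x, y, 0) := by
        ext <;> simp <;> ring
      show (1 - r) • ((t, x, y, 0) : ℝ × ℝ × ℝ × ℝ) + r • (t, 0, y, 0) ∈ _
      rw [this]
      refine ⟨⟨⟨b1, ?_, ?_, b4, b5, b6, b7⟩, .inl ⟨rfl, ?_⟩⟩, rfl, ?_⟩
      · simp only; nlinarith
      · simp only; nlinarith
      · rcases hb with h | h | ⟨g, h⟩
        · simp only at h; left; simp [h]
        · simp only at h; exact absurd h h2.ne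
        · right; right; exact ⟨g, h⟩
      · simp only; nlinarith
  apply contr_step _ T1 (fun p => (p.1, p.2.1, p.2.2.1, 0)) (by fun_prop)
  · rintro ⟨t, x, y, w⟩ ⟨h, h1, h2⟩
    simp only at h1 h2; subst h1
    exact ⟨h, zero_lt_one, h2⟩
  · rintro ⟨t, x, y, w⟩ ⟨h, h1, h2⟩
    exact ⟨XS_low hN h h1 le_rfl h.1.2.2.2.2.2.1, rfl, h2⟩
  · rintro ⟨t, x, y, w⟩ ⟨h, h1, h2⟩
    simp only at h1; subst h1; rfl
  · rintro ⟨t, x, y, w⟩ ⟨h, h1, h2⟩ r r0 r1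
    have : (1 - r) • ((t, x, y, w) : ℝ × ℝ × ℝ × ℝ) + r • (t, x, y, 0) = (t, x, y, (1 - r) * w) := by
      ext <;> simp <;> ring
    show (1 - r) • ((t, x, y, w) : ℝ × ℝ × ℝ × ℝ) + r • (t, x, y, 0) ∈ _
    rw [this]
    have h0 : 0 ≤ w := h.1.2.2.2.2.2.1
    have h3 : (1 - r) * w ≤ w := by nlinarith
    exact ⟨XS_low hN h h1 (by nlinarith) h3, lt_of_le_of_lt h3 h1, h2⟩

theorem contr_true (hN : ∀ k a b, m (kap k.1 k.2 a b) ≤ N k) :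
    ContractibleSpace ↥(XS m N ∩ OO N (.inl true)) := by
  let T2 : Set (ℝ × ℝ × ℝ × ℝ) := {p | p.2.2.2 = 0 ∧ p.2.1 = 1 ∧ 0 ≤ p.1 ∧ 0 ≤ p.2.2.1 ∧ p.2.2.1 ≤ 4 * p.1 + 4}
  have c2 : ContractibleSpace T2 := by
    apply Convex.contractibleSpace
    · rintro ⟨t, x, y, w⟩ ⟨h1, h2, h3, h4, h5⟩ ⟨t', x', y', w'⟩ ⟨h1', h2', h3', h4', h5'⟩ a b ha hb hab
      simp only at h1 h2 h3 h4 h5 h1' h2' h3' h4' h5'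
      refine ⟨?_, ?_, ?_, ?_, ?_⟩ <;> simp [h1, h1', h2, h2']
      · exact hab
      · positivity
      · positivity
      · nlinarith
    · exact ⟨(0, 1, 0, 0), by simp [T2]⟩
  let T1 : Set (ℝ × ℝ × ℝ × ℝ) := {p | p ∈ XS m N ∧ p.2.2.2 = 0 ∧ 0 < p.2.1}
  have c1 : ContractibleSpace T1 := by
    apply contr_step T1 T2 (fun p => (p.1, 1, p.2.2.1, 0)) (by fun_prop)
    · rintro ⟨t, x, y, w⟩ ⟨h1, h2, h3, h4, h5⟩
      simp only at h1 h2 h3 h4 h5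
      subst h1 h2
      exact ⟨⟨⟨h3, zero_le_one, le_rfl, h4, h5, le_rfl, zero_le_one⟩, .inl ⟨rfl, .inr (.inl rfl)⟩⟩, rfl,
        zero_lt_one⟩
    · rintro ⟨t, x, y, w⟩ ⟨⟨⟨b1, b2, b3, b4, b5, b6, b7⟩, _⟩, _⟩
      exact ⟨rfl, rfl, b1, b4, b5⟩
    · rintro ⟨t, x, y, w⟩ ⟨h1, h2, h3, h4, h5⟩
      simp only at h1 h2 h3 h4 h5
      subst h1 h2; rfl
    · rintro ⟨t, x, y, w⟩ ⟨h, h1, h2⟩ r r0 r1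
      have hb := low_bas hN h (by rw [h1]; exact zero_lt_one)
      obtain ⟨⟨b1, b2, b3, b4, b5, b6, b7⟩, _⟩ := h
      simp only at h1 h2 b1 b2 b3 b4 b5 b6 b7
      subst h1
      have : (1 - r) • ((t, x, y, 0) : ℝ × ℝ × ℝ × ℝ) + r • (t, 1, y, 0) = (t, (1 - r) * x + r, y, 0) := by
        ext <;> simp <;> ring
      show (1 - r) • ((t, x, y, 0) : ℝ × ℝ × ℝ × ℝ) + r • (t, 1, y, 0) ∈ _
      rw [this]
      refine ⟨⟨⟨b1, ?_, ?_, b4, b5, b6, b7⟩, .inl ⟨rfl, ?_⟩⟩, rfl, ?_⟩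
      · simp only; nlinarith
      · simp only; nlinarith
      · rcases hb with h | h | ⟨g, h⟩
        · simp only at h; exact absurd h h2.ne'
        · simp only at h; right; left; simp [h]
        · right; right; exact ⟨g, h⟩
      · simp only; nlinarith
  apply contr_step _ T1 (fun p => (p.1, p.2.1, p.2.2.1, 0)) (by fun_prop)
  · rintro ⟨t, x, y, w⟩ ⟨h, h1, h2⟩
    simp only at h1 h2; subst h1
    exact ⟨h, zero_lt_one, h2⟩
  · rintro ⟨t, x, y, w⟩ ⟨h, h1, h2⟩
    exact ⟨XS_low hN h h1 le_rfl h.1.2.2.2.2.2.1, rfl, h2⟩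
  · rintro ⟨t, x, y, w⟩ ⟨h, h1, h2⟩
    simp only at h1; subst h1; rfl
  · rintro ⟨t, x, y, w⟩ ⟨h, h1, h2⟩ r r0 r1
    have : (1 - r) • ((t, x, y, w) : ℝ × ℝ × ℝ × ℝ) + r • (t, x, y, 0) = (t, x, y, (1 - r) * w) := by
      ext <;> simp <;> ring
    show (1 - r) • ((t, x, y, w) : ℝ × ℝ × ℝ × ℝ) + r • (t, x, y, 0) ∈ _
    rw [this]
    have h0 : 0 ≤ w := h.1.2.2.2.2.2.1
    have h3 : (1 - r) * w ≤ w := by nlinarith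
    exact ⟨XS_low hN h h1 (by nlinarith) h3, lt_of_le_of_lt h3 h1, h2⟩

theorem W_range (hNi : Function.Injective N) {p : ℝ × ℝ × ℝ × ℝ} {k : G × G} (hp : p ∈ XS m N)
    (hk : p ∈ OO N (.inr k)) : (N k : ℝ) ≤ p.1 ∧ p.1 ≤ N k + 1 / 2 := by
  by_cases hw : p.2.2.2 < 1
  · exact DD_range hp.1 (mid_DD hNi hp hw hk)
  obtain ⟨hB, ⟨h, _⟩ | ⟨k', h⟩⟩ := hp
  · exact absurd h hk.1.ne'
  have h2 : (N k' : ℝ) ≤ p.1 ∧ p.1 ≤ N k' + 1 / 2 := by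
    rcases h with h | h
    · exact DD_range hB h
    · exact h.2
  obtain ⟨_, hk1, hk2⟩ := hk
  rwa [N_unique hNi (k' := k') hk1 hk2 (by linarith) (by linarith)]

theorem contr_cap (hNi : Function.Injective N) (k : G × G) :
    ContractibleSpace ↥(XS m N ∩ OO N (.inr k)) := by
  let T : Set (ℝ × ℝ × ℝ × ℝ) := {p | Box p ∧ Cap N k p}
  have c2 : ContractibleSpace T := by
    apply Convex.contractibleSpace
    · rintro ⟨t, x, y, w⟩ ⟨⟨b1, b2, b3, b4, b5, b6, b7⟩, h1, h2, h3⟩ ⟨t', x', y', w'⟩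
        ⟨⟨b1', b2', b3', b4', b5', b6', b7'⟩, h1', h2', h3'⟩ a b ha hb hab
      simp only at h1 h2 h3 h1' h2' h3' b1 b2 b3 b4 b5 b6 b7 b1' b2' b3' b4' b5' b6' b7'
      obtain rfl : b = 1 - a := by linarith
      refine ⟨⟨?_, ?_, ?_, ?_, ?_, ?_, ?_⟩, ?_, ?_, ?_⟩ <;> simp [h1, h1'] <;> nlinarith
    · refine ⟨(N k, 0, 0, 1), ⟨?_, ?_, ?_, ?_, ?_, ?_, ?_⟩, ?_, ?_, ?_⟩ <;> simp <;> positivity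
  apply contr_step _ T (fun p => (p.1, p.2.1, p.2.2.1, 1)) (by fun_prop)
  · rintro ⟨t, x, y, w⟩ ⟨hB, h1, h2, h3⟩
    simp only at h1 h2 h3; subst h1
    exact ⟨⟨hB, .inr ⟨k, .inr ⟨rfl, h2, h3⟩⟩⟩, zero_lt_one, by simp only; linarith, by simp only; linarith⟩
  · rintro ⟨t, x, y, w⟩ ⟨h, h1⟩
    have hr := W_range hNi h h1
    obtain ⟨⟨b1, b2, b3, b4, b5, b6, b7⟩, _⟩ := h
    exact ⟨⟨b1, b2, b3, b4, b5, zero_le_one, le_rfl⟩, rfl, hr⟩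
  · rintro ⟨t, x, y, w⟩ ⟨_, h1, _⟩
    simp only at h1; subst h1; rfl
  · rintro ⟨t, x, y, w⟩ ⟨h, h1⟩ r r0 r1
    have : (1 - r) • ((t, x, y, w) : ℝ × ℝ × ℝ × ℝ) + r • (t, x, y, 1) = (t, x, y, (1 - r) * w + r) := by
      ext <;> simp <;> ring
    show (1 - r) • ((t, x, y, w) : ℝ × ℝ × ℝ × ℝ) + r • (t, x, y, 1) ∈ _
    rw [this]
    by_cases hw : w < 1
    · have hd := mid_DD hNi h hw h1
      obtain ⟨⟨b1, b2, b3, b4, b5, b6, b7⟩, _⟩ := h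
      obtain ⟨h1, h2⟩ := h1
      simp only at b6 b7 h1
      exact ⟨⟨⟨b1, b2, b3, b4, b5, by simp only; nlinarith, by simp only; nlinarith⟩, .inr ⟨k, .inl hd⟩⟩,
        by simp only; nlinarith, h2⟩
    · obtain rfl : w = 1 := le_antisymm h.1.2.2.2.2.2.2 (not_lt.1 hw)
      have : (1 - r) * 1 + r = 1 := by ring
      rw [this]
      exact ⟨h, h1⟩
end Geo
end PiOne

namespace PiOne

open Set Topology unitInterval

section Geo
set_option linter.unusedSectionVars false
variable {G : Type} [Group G] {m : G → ℕ} {N : G × G → ℕ}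

theorem joined_seg {E : Type*} [AddCommGroup E] [Module ℝ E] [TopologicalSpace E]
    [ContinuousAdd E] [ContinuousSMul ℝ E] {F : Set E} {p q : E}
    (h : ∀ r : ℝ, 0 ≤ r → r ≤ 1 → (1 - r) • p + r • q ∈ F) : JoinedIn F p q := by
  apply JoinedIn.of_segment_subset
  rw [segment_eq_image]
  rintro _ ⟨r, ⟨h0, h1⟩, rfl⟩
  exact h r h0 h1

theorem joined_vert {F : Set (ℝ × ℝ × ℝ × ℝ)} {t x y w w' : ℝ}
    (h : ∀ v, min w w' ≤ v → v ≤ max w w' → (t, x, y, v) ∈ F) :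
    JoinedIn F (t, x, y, w) (t, x, y, w') := by
  apply joined_seg
  intro r h0 h1
  have : (1 - r) • ((t, x, y, w) : ℝ × ℝ × ℝ × ℝ) + r • (t, x, y, w') = (t, x, y, (1 - r) * w + r * w') := by
    ext <;> simp <;> ring
  rw [this]
  apply h
  · exact le_mix h0 h1 (min_le_left _ _) (min_le_right _ _)
  · exact mix_le h0 h1 (le_max_left _ _) (le_max_right _ _)

/-- Centre of a tube. -/
noncomputable def cc (m : G → ℕ) (g : G) : ℝ × ℝ × ℝ × ℝ := (m g, 1 / 2, 4 * m g, 0)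

theorem tube_join (hm : Function.Injective m) (hN : ∀ k a b, m (kap k.1 k.2 a b) ≤ N k)
    {p : ℝ × ℝ × ℝ × ℝ} {g : G} (hp : p ∈ XS m N ∩ (OO N (.inl false) ∩ OO N (.inl true)))
    (h1 : 4 * (m g : ℝ) ≤ p.2.2.1) (h2 : p.2.2.1 ≤ 4 * (m g : ℝ) + 3) :
    JoinedIn (XS m N ∩ (OO N (.inl false) ∩ OO N (.inl true))) p (cc m g) := by
  obtain ⟨t, x, y, w⟩ := p
  obtain ⟨h, ⟨hw, hx1⟩, ⟨_, hx0⟩⟩ := hp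
  have hb := low_bas hN h hw
  have ht : (m g : ℝ) ≤ t := by
    rcases hb with h | h | ⟨g', h⟩
    · exact absurd h hx0.ne'
    · exact absurd h hx1.ne
    · rw [tube_unique hm h1 h2 h.2.1 h.2.2 (by simp)]
      exact h.1
  simp only at h1 h2 hw hx0 hx1
  have hB := h.1
  simp only [Box] at hB
  have j1 : JoinedIn (XS m N ∩ (OO N (.inl false) ∩ OO N (.inl true))) (t, x, y, w) (t, x, y, 0) := by
    apply joined_vert
    intro v v0 v1
    rw [min_eq_right hB.2.2.2.2.2.1] at v0
    rw [max_eq_left hB.2.2.2.2.2.1] at v1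
    have hv := lt_of_le_of_lt v1 hw
    exact ⟨XS_low hN h hw v0 v1, ⟨hv, hx1⟩, hv, hx0⟩
  refine j1.trans ?_
  apply joined_seg
  intro r r0 r1
  have : (1 - r) • ((t, x, y, 0) : ℝ × ℝ × ℝ × ℝ) + r • cc m g =
      ((1 - r) * t + r * m g, (1 - r) * x + r * (1 / 2), (1 - r) * y + r * (4 * m g), 0) := by
    ext <;> simp [cc]
  rw [this]
  have k1 : (m g : ℝ) ≤ (1 - r) * t + r * m g := le_mix r0 r1 ht le_rfl
  have k2 := le_mix r0 r1 h1 le_rfl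
  have k3 : (1 - r) * y + r * (4 * m g) ≤ 4 * (m g : ℝ) + 3 := mix_le r0 r1 h2 (by linarith)
  have k4 : 0 < (1 - r) * x + r * (1 / 2) := by nlinarith
  have k5 : (1 - r) * x + r * (1 / 2) < 1 := by nlinarith
  have k0 : (0 : ℝ) ≤ m g := by positivity
  refine ⟨⟨⟨?_, ?_, ?_, ?_, ?_, ?_, ?_⟩, .inl ⟨rfl, .inr (.inr ⟨g, k1, k2, k3⟩)⟩⟩, ⟨?_, ?_⟩, ⟨?_, ?_⟩⟩ <;> simp only <;> linarith

theorem PP_join (hN : ∀ k a b, m (kap k.1 k.2 a b) ≤ N k)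
    {p : ℝ × ℝ × ℝ × ℝ} {k : G × G} {a : Bool} (hp : p ∈ XS m N ∩ (OO N (.inl false) ∩ OO N (.inr k)))
    (h : PP m N k a p) :
    JoinedIn (XS m N ∩ (OO N (.inl false) ∩ OO N (.inr k))) p (N k + bi a / 2, 0, 0, 1 / 2) := by
  obtain ⟨t, x, y, w⟩ := p
  obtain ⟨hX, ⟨hw, hx1⟩, ⟨hw0, ht0, ht1⟩⟩ := hp
  obtain ⟨⟨b1, b2, b3, b4, b5, b6, b7⟩, _⟩ := hX
  simp only at hw hx1 hw0 ht0 ht1 b1 b2 b3 b4 b5 b6 b7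
  have hba : 0 ≤ bi a ∧ bi a ≤ 1 := by rcases bi_cases a with e | e <;> rw [e] <;> norm_num
  have hNk : (0 : ℝ) ≤ N k := by positivity
  have j1 : JoinedIn (XS m N ∩ (OO N (.inl false) ∩ OO N (.inr k))) (t, x, y, w) (t, x, y, 1 / 2) := by
    apply joined_vert
    intro v v0 v1
    have hv0 : 0 < v := lt_of_lt_of_le (lt_min hw0 (by norm_num)) v0
    have hv1 : v < 1 := lt_of_le_of_lt v1 (max_lt hw (by norm_num))
    exact ⟨⟨⟨b1, b2, b3, b4, b5, hv0.le, hv1.le⟩, .inr ⟨k, .inl ⟨a, .inl h⟩⟩⟩, ⟨hv1, hx1⟩, hv0, ht0, ht1⟩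
  have j3 : ∀ y' : ℝ, 0 ≤ y' → y' ≤ 4 * (N k + bi a / 2) + 4 →
      JoinedIn (XS m N ∩ (OO N (.inl false) ∩ OO N (.inr k))) (N k + bi a / 2, 0, y', 1 / 2)
        (N k + bi a / 2, 0, 0, 1 / 2) := by
    intro y' y0 y1
    apply joined_seg
    intro r r0 r1
    have : (1 - r) • ((N k + bi a / 2, 0, y', 1 / 2) : ℝ × ℝ × ℝ × ℝ) + r • (N k + bi a / 2, 0, 0, 1 / 2) =
        (N k + bi a / 2, 0, (1 - r) * y', 1 / 2) := by
      ext <;> simp <;> ring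
    rw [this]
    have k3 : 0 ≤ (1 - r) * y' := by nlinarith
    have k4 : (1 - r) * y' ≤ y' := by nlinarith
    refine ⟨⟨⟨?_, ?_, ?_, ?_, ?_, ?_, ?_⟩, .inr ⟨k, .inl ⟨a, .inl (.inl ⟨rfl, rfl⟩)⟩⟩⟩, ⟨?_, ?_⟩, ⟨?_, ?_, ?_⟩⟩ <;> simp only <;> linarith
  refine j1.trans ?_
  rcases h with ⟨h0, h1⟩ | ⟨b, h⟩
  · simp only at h0 h1
    subst h0 h1
    exact j3 y b4 b5
  · have hbb : 0 ≤ bi b ∧ bi b ≤ 1 := by rcases bi_cases b with e | e <;> rw [e] <;> norm_num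
    have h1 := h.1
    have h2 := h.2
    simp only at h1 h2
    have hmn : y ≤ 4 * N k + 4 := by
      have : (m (kap k.1 k.2 a b) : ℝ) ≤ N k := by exact_mod_cast hN k a b
      linarith
    refine JoinedIn.trans ?_ (j3 y b4 (by linarith))
    apply joined_seg
    intro r r0 r1
    have : (1 - r) • ((t, x, y, 1 / 2) : ℝ × ℝ × ℝ × ℝ) + r • (N k + bi a / 2, 0, y, 1 / 2) =
        ((1 - r) * t + r * (N k + bi a / 2), (1 - r) * x, y, 1 / 2) := by
      ext <;> simp <;> ring
    rw [this]
    have hs : Sg m N k a b ((1 - r) * t + r * (N k + bi a / 2), (1 - r) * x, y, 1 / 2) := by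
      refine ⟨h1, ?_⟩
      simp only
      rw [h2]; ring
    have k1 := le_mix (c := N k) (a := t) (b := N k + bi a / 2) r0 r1 (by rw [h2]; nlinarith) (by linarith)
    have k2 := mix_le (c := N k + 1 / 2) (a := t) (b := N k + bi a / 2) r0 r1 (by rw [h2]; nlinarith) (by linarith)
    have k3 : 0 ≤ (1 - r) * x := by nlinarith
    have k4 : (1 - r) * x ≤ x := by nlinarith
    refine ⟨⟨⟨?_, ?_, ?_, ?_, ?_, ?_, ?_⟩, .inr ⟨k, .inl ⟨a, .inl (.inr ⟨b, hs⟩)⟩⟩⟩, ⟨?_, ?_⟩, ⟨?_, ?_, ?_⟩⟩ <;> simp only <;> linarith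
theorem RR_join (hN : ∀ k a b, m (kap k.1 k.2 a b) ≤ N k)
    {p : ℝ × ℝ × ℝ × ℝ} {k : G × G} {a : Bool} (hp : p ∈ XS m N ∩ (OO N (.inl true) ∩ OO N (.inr k)))
    (h : RR m N k a p) :
    JoinedIn (XS m N ∩ (OO N (.inl true) ∩ OO N (.inr k))) p (N k + bi a / 2, 1, 0, 1 / 2) := by
  obtain ⟨t, x, y, w⟩ := p
  obtain ⟨hX, ⟨hw, hx0⟩, ⟨hw0, ht0, ht1⟩⟩ := hp
  obtain ⟨⟨b1, b2, b3, b4, b5, b6, b7⟩, _⟩ := hX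
  simp only at hw hx0 hw0 ht0 ht1 b1 b2 b3 b4 b5 b6 b7
  have hba : 0 ≤ bi a ∧ bi a ≤ 1 := by rcases bi_cases a with e | e <;> rw [e] <;> norm_num
  have hNk : (0 : ℝ) ≤ N k := by positivity
  have j1 : JoinedIn (XS m N ∩ (OO N (.inl true) ∩ OO N (.inr k))) (t, x, y, w) (t, x, y, 1 / 2) := by
    apply joined_vert
    intro v v0 v1
    have hv0 : 0 < v := lt_of_lt_of_le (lt_min hw0 (by norm_num)) v0
    have hv1 : v < 1 := lt_of_le_of_lt v1 (max_lt hw (by norm_num))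
    exact ⟨⟨⟨b1, b2, b3, b4, b5, hv0.le, hv1.le⟩, .inr ⟨k, .inl ⟨a, .inr h⟩⟩⟩, ⟨hv1, hx0⟩, hv0, ht0, ht1⟩
  have j3 : ∀ y' : ℝ, 0 ≤ y' → y' ≤ 4 * (N k + bi a / 2) + 4 →
      JoinedIn (XS m N ∩ (OO N (.inl true) ∩ OO N (.inr k))) (N k + bi a / 2, 1, y', 1 / 2)
        (N k + bi a / 2, 1, 0, 1 / 2) := by
    intro y' y0 y1
    apply joined_seg
    intro r r0 r1
    have : (1 - r) • ((N k + bi a / 2, 1, y', 1 / 2) : ℝ × ℝ × ℝ × ℝ) + r • (N k + bi a / 2, 1, 0, 1 / 2) =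
        (N k + bi a / 2, 1, (1 - r) * y', 1 / 2) := by
      ext <;> simp <;> ring
    rw [this]
    have k3 : 0 ≤ (1 - r) * y' := by nlinarith
    have k4 : (1 - r) * y' ≤ y' := by nlinarith
    refine ⟨⟨⟨?_, ?_, ?_, ?_, ?_, ?_, ?_⟩, .inr ⟨k, .inl ⟨a, .inr (.inl ⟨rfl, rfl⟩)⟩⟩⟩, ⟨?_, ?_⟩, ⟨?_, ?_, ?_⟩⟩ <;> simp only <;> linarith
  refine j1.trans ?_
  rcases h with ⟨h0, h1⟩ | ⟨b, h⟩
  · simp only at h0 h1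
    subst h0 h1
    exact j3 y b4 b5
  · have hbb : 0 ≤ bi b ∧ bi b ≤ 1 := by rcases bi_cases b with e | e <;> rw [e] <;> norm_num
    have h1 := h.1
    have h2 := h.2
    simp only at h1 h2
    have hmn : y ≤ 4 * N k + 4 := by
      have : (m (kap k.1 k.2 b a) : ℝ) ≤ N k := by exact_mod_cast hN k b a
      linarith
    refine JoinedIn.trans ?_ (j3 y b4 (by linarith))
    apply joined_seg
    intro r r0 r1
    have : (1 - r) • ((t, x, y, 1 / 2) : ℝ × ℝ × ℝ × ℝ) + r • (N k + bi a / 2, 1, y, 1 / 2) =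
        ((1 - r) * t + r * (N k + bi a / 2), (1 - r) * x + r, y, 1 / 2) := by
      ext <;> simp <;> ring
    rw [this]
    have hs : Sg m N k b a ((1 - r) * t + r * (N k + bi a / 2), (1 - r) * x + r, y, 1 / 2) := by
      refine ⟨h1, ?_⟩
      simp only
      rw [h2]; ring
    have k1 := le_mix (c := N k) (a := t) (b := N k + bi a / 2) r0 r1 (by rw [h2]; nlinarith) (by linarith)
    have k2 := mix_le (c := N k + 1 / 2) (a := t) (b := N k + bi a / 2) r0 r1 (by rw [h2]; nlinarith) (by linarith)
    have k3 : x ≤ (1 - r) * x + r := by nlinarith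
    have k4 : (1 - r) * x + r ≤ 1 := by nlinarith
    refine ⟨⟨⟨?_, ?_, ?_, ?_, ?_, ?_, ?_⟩, .inr ⟨k, .inl ⟨a, .inr (.inr ⟨b, hs⟩)⟩⟩⟩, ⟨?_, ?_⟩, ⟨?_, ?_, ?_⟩⟩ <;> simp only <;> linarith
end Geo
end PiOne

namespace PiOne

open Set Topology unitInterval

section Geo
set_option linter.unusedSectionVars false
variable {G : Type} [Group G] {m : G → ℕ} {N : G × G → ℕ}

/-- The four midpoints. -/
noncomputable def zz (m : G → ℕ) (N : G × G → ℕ) (k : G × G) (a b : Bool) : ℝ × ℝ × ℝ × ℝ :=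
  (N k + (bi a * (1 - 1 / 2) + bi b * (1 / 2)) / 2, 1 / 2, 4 * m (kap k.1 k.2 a b) + (bi a + 2 * bi b), 1 / 2)

theorem zz_Sg (k : G × G) (a b : Bool) : Sg m N k a b (zz m N k a b) := ⟨rfl, rfl⟩

theorem bi_bd (a : Bool) : 0 ≤ bi a ∧ bi a ≤ 1 := by
  rcases bi_cases a with e | e <;> rw [e] <;> norm_num

theorem zz_mem (hN : ∀ k a b, m (kap k.1 k.2 a b) ≤ N k) (k : G × G) (a b : Bool) :
    zz m N k a b ∈ XS m N := by
  have h1 := bi_bd a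
  have h2 := bi_bd b
  have h3 : (m (kap k.1 k.2 a b) : ℝ) ≤ N k := by exact_mod_cast hN k a b
  have h4 : (0 : ℝ) ≤ m (kap k.1 k.2 a b) := by positivity
  have h5 : (0 : ℝ) ≤ N k := by positivity
  refine ⟨⟨?_, ?_, ?_, ?_, ?_, ?_, ?_⟩, .inr ⟨k, .inl ⟨a, .inl (.inr ⟨b, zz_Sg k a b⟩)⟩⟩⟩ <;>
  simp only [zz]
  · linarith
  · norm_num
  · norm_num
  · linarith
  · rcases bi_cases a with e | e <;> rcases bi_cases b with e' | e' <;> rw [e, e'] <;> linarith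
  · norm_num
  · norm_num

theorem zz_O0 (k : G × G) (a b : Bool) : zz m N k a b ∈ OO N (.inl false) := by
  constructor <;> simp only [zz] <;> norm_num
theorem zz_O1 (k : G × G) (a b : Bool) : zz m N k a b ∈ OO N (.inl true) := by
  constructor <;> simp only [zz] <;> norm_num
theorem zz_Ok (k : G × G) (a b : Bool) : zz m N k a b ∈ OO N (.inr k) := by
  have h1 := bi_bd a
  have h2 := bi_bd b
  refine ⟨?_, ?_, ?_⟩ <;> simp only [zz] <;> linarith

theorem cc_mem (g : G) : cc m g ∈ XS m N := by
  have h4 : (0 : ℝ) ≤ m g := by positivity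
  refine ⟨⟨?_, ?_, ?_, ?_, ?_, ?_, ?_⟩, .inl ⟨rfl, .inr (.inr ⟨g, ?_, ?_, ?_⟩)⟩⟩ <;>
  simp only [cc] <;> linarith

theorem cc_O (g : G) (e : Bool) : cc m g ∈ OO N (.inl e) := by
  cases e <;> constructor <;> simp only [cc] <;> norm_num

/-- Bit weights. -/
def aw (k : G × G) (a : Bool) : G := if a then k.1 else 1
/-- Bit weights. -/
def bw (k : G × G) (b : Bool) : G := if b then k.1 * k.2 else k.1

theorem kap_eq (k : G × G) (a b : Bool) : kap k.1 k.2 a b = (aw k a)⁻¹ * bw k b := rfl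

open Classical in
/-- Tube label. -/
noncomputable def tl (m : G → ℕ) (y : ℝ) : G :=
  if h : ∃ g, 4 * (m g : ℝ) ≤ y ∧ y ≤ 4 * (m g : ℝ) + 3 then h.choose else 1

theorem tl_eq (hm : Function.Injective m) {y : ℝ} {g : G} (h1 : 4 * (m g : ℝ) ≤ y)
    (h2 : y ≤ 4 * (m g : ℝ) + 3) : tl m y = g := by
  have h : ∃ g, 4 * (m g : ℝ) ≤ y ∧ y ≤ 4 * (m g : ℝ) + 3 := ⟨g, h1, h2⟩
  rw [tl, dif_pos h]
  exact tube_unique hm h.choose_spec.1 h.choose_spec.2 h1 h2 (by simp)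

open Classical in
/-- Holonomy potentials. -/
noncomputable def sig (m : G → ℕ) (N : G × G → ℕ) : Bool ⊕ (G × G) → ℝ × ℝ × ℝ × ℝ → G
  | .inl false, _ => 1
  | .inl true, p => if p.2.1 < 1 then tl m p.2.2.1 else 1
  | .inr k, p => if p.2.1 < 1 then (aw k (decide (PP m N k true p)))⁻¹
      else (bw k (decide (RR m N k true p)))⁻¹

theorem dec_PP (hm : Function.Injective m) {k : G × G} {a : Bool} {p : ℝ × ℝ × ℝ × ℝ} (h : PP m N k a p)
    [Decidable (PP m N k true p)] : decide (PP m N k true p) = a := by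
  cases a
  · simp only [decide_eq_false_iff_not]
    intro h'; simpa using PP_unique hm h h'
  · simpa using h

theorem dec_RR (hm : Function.Injective m) {k : G × G} {a : Bool} {p : ℝ × ℝ × ℝ × ℝ} (h : RR m N k a p)
    [Decidable (RR m N k true p)] : decide (RR m N k true p) = a := by
  cases a
  · simp only [decide_eq_false_iff_not]
    intro h'; simpa using RR_unique hm h h'
  · simpa using h

theorem ex_PP (hNi : Function.Injective N) {k : G × G} {p : ℝ × ℝ × ℝ × ℝ} (hp : p ∈ XS m N)
    (h0 : p ∈ OO N (.inl false)) (hk : p ∈ OO N (.inr k)) : ∃ a, PP m N k a p := by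
  obtain ⟨a, h | h | ⟨b, h⟩⟩ := mid_DD hNi hp h0.1 hk
  · exact ⟨a, h⟩
  · exact absurd h.1 h0.2.ne
  · exact ⟨b, .inr ⟨a, h⟩⟩

theorem ex_RR (hNi : Function.Injective N) {k : G × G} {p : ℝ × ℝ × ℝ × ℝ} (hp : p ∈ XS m N)
    (h0 : p ∈ OO N (.inl true)) (hk : p ∈ OO N (.inr k)) : ∃ a, RR m N k a p := by
  obtain ⟨a, (h | ⟨b, h⟩) | h⟩ := mid_DD hNi hp h0.1 hk
  · exact absurd h.1 h0.2.ne'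
  · exact ⟨b, .inr ⟨a, h⟩⟩
  · exact ⟨a, h⟩

theorem bool_not : ∀ a a' : Bool, a' ≠ a → a' = !a := by decide

theorem joined_sub2 {E : Type*} [TopologicalSpace E] {S O O' : Set E} {p q : E} (hp : p ∈ S) (hq : q ∈ S)
    (h : JoinedIn (S ∩ (O ∩ O')) p q) :
    JoinedIn ((Subtype.val : S → E) ⁻¹' O ∩ (Subtype.val : S → E) ⁻¹' O') ⟨p, hp⟩ ⟨q, hq⟩ :=
  joined_sub (S := S) (O := O ∩ O') (p := ⟨p, hp⟩) (q := ⟨q, hq⟩) h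

open Classical in
theorem sig_PP (hm : Function.Injective m) {k : G × G} {a : Bool} {p : ℝ × ℝ × ℝ × ℝ}
    (h0 : p ∈ OO N (.inl false)) (h : PP m N k a p) : sig m N (.inr k) p = (aw k a)⁻¹ := by
  rw [sig, if_pos h0.2, dec_PP hm h]

open Classical in
theorem sig_RR (hm : Function.Injective m) (hNi : Function.Injective N)
    (hN : ∀ k a b, m (kap k.1 k.2 a b) ≤ N k) {k : G × G} {b : Bool} {p : ℝ × ℝ × ℝ × ℝ}
    (hp : p ∈ XS m N)
    (h1 : p ∈ OO N (.inl true)) (hk : p ∈ OO N (.inr k)) (h : RR m N k b p) :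
    (sig m N (.inr k) p)⁻¹ * sig m N (.inl true) p = bw k b := by
  by_cases hx : p.2.1 < 1
  · obtain ⟨a, h⟩ := h.resolve_left (fun h => hx.ne h.1)
    have ht := Sg_tube hN hp.1 h
    rw [sig_PP hm ⟨h1.1, hx⟩ (.inr ⟨b, h⟩), sig, if_pos hx, tl_eq hm ht.2.1 ht.2.2, kap_eq]
    group
  · rw [sig, sig, if_neg hx, if_neg hx, dec_RR hm h]
    simp

theorem sig_loc (hm : Function.Injective m) (hNi : Function.Injective N)
    (hN : ∀ k a b, m (kap k.1 k.2 a b) ≤ N k) (i j : Bool ⊕ (G × G)) (p : ℝ × ℝ × ℝ × ℝ)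
    (hp : p ∈ XS m N) (hi : p ∈ OO N i) (hj : p ∈ OO N j) :
    ∀ᶠ q in 𝓝 p, q ∈ XS m N → q ∈ OO N i → q ∈ OO N j →
      (sig m N j q)⁻¹ * sig m N i q = (sig m N j p)⁻¹ * sig m N i p := by
  have inv : ∀ i j, (∀ᶠ q in 𝓝 p, q ∈ XS m N → q ∈ OO N i → q ∈ OO N j →
      (sig m N j q)⁻¹ * sig m N i q = (sig m N j p)⁻¹ * sig m N i p) → 
      (∀ᶠ q in 𝓝 p, q ∈ XS m N → q ∈ OO N j → q ∈ OO N i →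
      (sig m N i q)⁻¹ * sig m N j q = (sig m N i p)⁻¹ * sig m N j p) := by
    intro i j h
    filter_upwards [h] with q hq h1 h2 h3
    have := congrArg (·⁻¹) (hq h1 h3 h2)
    simpa using this
  have same : ∀ i, ∀ᶠ q in 𝓝 p, q ∈ XS m N → q ∈ OO N i → q ∈ OO N i →
      (sig m N i q)⁻¹ * sig m N i q = (sig m N i p)⁻¹ * sig m N i p := by
    intro i; simp
  have tube : ∀ q, q ∈ XS m N → q ∈ OO N (.inl false) → q ∈ OO N (.inl true) → 
      ∃ g, Tube m g q := by
    intro q hq h0 h1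
    rcases low_bas hN hq h0.1 with h | h | h
    · exact absurd h h1.2.ne'
    · exact absurd h h0.2.ne
    · exact h
  have c01 : p ∈ OO N (.inl false) → p ∈ OO N (.inl true) → 
      (∀ᶠ q in 𝓝 p, q ∈ XS m N → q ∈ OO N (.inl true) → q ∈ OO N (.inl false) →
      (sig m N (.inl false) q)⁻¹ * sig m N (.inl true) q =
        (sig m N (.inl false) p)⁻¹ * sig m N (.inl true) p) := by
    intro h0 h1
    obtain ⟨g, hg⟩ := tube p hp h0 h1
    have hc : Continuous (fun q : ℝ × ℝ × ℝ × ℝ => |q.2.2.1 - p.2.2.1|) := by fun_prop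
    filter_upwards [(isOpen_lt hc continuous_const).mem_nhds
      (show |p.2.2.1 - p.2.2.1| < (1 : ℝ) by simp)] with q hq hqX hq1 hq0
    obtain ⟨g', hg'⟩ := tube q hqX hq0 hq1
    have e := tube_unique hm hg'.2.1 hg'.2.2 hg.2.1 hg.2.2 hq
    simp only [sig]
    rw [if_pos h0.2, if_pos hq0.2, tl_eq hm hg'.2.1 hg'.2.2, tl_eq hm hg.2.1 hg.2.2, e]
  have c0k : ∀ k, p ∈ OO N (.inl false) → p ∈ OO N (.inr k) → 
      (∀ᶠ q in 𝓝 p, q ∈ XS m N → q ∈ OO N (.inr k) → q ∈ OO N (.inl false) →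
      (sig m N (.inl false) q)⁻¹ * sig m N (.inr k) q =
        (sig m N (.inl false) p)⁻¹ * sig m N (.inr k) p) := by
    intro k h0 hk
    obtain ⟨a, ha⟩ := ex_PP hNi hp h0 hk
    have hna : ¬ PP m N k (!a) p := fun h => by simpa using PP_unique hm ha h
    filter_upwards [(closed_PP (m := m) (N := N) k (!a)).isOpen_compl.mem_nhds hna] with q hq hqX hqk hq0
    obtain ⟨a', ha'⟩ := ex_PP hNi hqX hq0 hqk
    have : a' = a := by
      by_contra hne
      have : a' = !a := bool_not _ _ hne
      subst this
      exact hq ha'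
    subst this
    rw [sig_PP hm h0 ha, sig_PP hm hq0 ha']
    rfl
  have c1k : ∀ k, p ∈ OO N (.inl true) → p ∈ OO N (.inr k) → 
      (∀ᶠ q in 𝓝 p, q ∈ XS m N → q ∈ OO N (.inl true) → q ∈ OO N (.inr k) →
      (sig m N (.inr k) q)⁻¹ * sig m N (.inl true) q =
        (sig m N (.inr k) p)⁻¹ * sig m N (.inl true) p) := by
    intro k h0 hk
    obtain ⟨a, ha⟩ := ex_RR hNi hp h0 hk
    have hna : ¬ RR m N k (!a) p := fun h => by simpa using RR_unique hm ha h
    filter_upwards [(closed_RR (m := m) (N := N) k (!a)).isOpen_compl.mem_nhds hna] with q hq hqX hq0 hqk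
    obtain ⟨a', ha'⟩ := ex_RR hNi hqX hq0 hqk
    have : a' = a := by
      by_contra hne
      have : a' = !a := bool_not _ _ hne
      subst this
      exact hq ha'
    subst this
    rw [sig_RR hm hNi hN hp h0 hk ha, sig_RR hm hNi hN hqX hq0 hqk ha']
  rcases i with (_ | _) | k <;> rcases j with (_ | _) | k'
  · exact same _
  · exact inv _ _ (c01 hi hj)
  · exact inv _ _ (c0k _ hi hj)
  · exact c01 hj hi
  · exact same _
  · exact c1k _ hi hj
  · exact c0k _ hj hi
  · exact inv _ _ (c1k _ hj hi)
  · obtain rfl := N_unique hNi hi.2.1 hi.2.2 hj.2.1 hj.2.2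
    exact same _

theorem open_OO (i : Bool ⊕ (G × G)) : IsOpen (OO N i) := by
  rcases i with (_ | _) | k <;> simp only [OO, ofPred_and]
  · exact (isOpen_lt (by fun_prop) (by fun_prop)).inter (isOpen_lt (by fun_prop) (by fun_prop))
  · exact (isOpen_lt (by fun_prop) (by fun_prop)).inter (isOpen_lt (by fun_prop) (by fun_prop))
  · exact (isOpen_lt (by fun_prop) (by fun_prop)).inter ((isOpen_lt (by fun_prop) (by fun_prop)).inter (isOpen_lt (by fun_prop) (by fun_prop)))

theorem cover (p : ℝ × ℝ × ℝ × ℝ) (hp : p ∈ XS m N) : ∃ i, p ∈ OO N i := by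
  by_cases hw : p.2.2.2 < 1
  · by_cases hx : p.2.1 < 1
    · exact ⟨.inl false, hw, hx⟩
    · exact ⟨.inl true, hw, by linarith⟩
  · obtain ⟨hB, ⟨h, _⟩ | ⟨k, h⟩⟩ := hp
    · rw [h] at hw; norm_num at hw
    · have : (N k : ℝ) ≤ p.1 ∧ p.1 ≤ N k + 1 / 2 := by
        rcases h with h | h
        · exact DD_range hB h
        · exact h.2
      exact ⟨.inr k, by linarith, by linarith, by linarith⟩

theorem XS_pi (hm : Function.Injective m) (hNi : Function.Injective N)
    (hN : ∀ k a b, m (kap k.1 k.2 a b) ≤ N k) : PathConnectedSpace (XS m N) ∧ 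
    Nonempty (FundamentalGroup (XS m N) ⟨cc m 1, cc_mem 1⟩ ≃* G) := by
  let U : Bool ⊕ (G × G) → Set (XS m N) := fun i => Subtype.val ⁻¹' OO N i
  have hsc : ∀ i, SimplyConnectedSpace (U i) := by
    intro i
    have : ContractibleSpace ↥(XS m N ∩ OO N i) := by
      rcases i with (_ | _) | k
      · exact contr_false hN
      · exact contr_true hN
      · exact contr_cap hNi k
    exact contr_sub _ _
  let c : G → XS m N := fun g => ⟨cc m g, cc_mem g⟩
  let z : G × G → Bool → Bool → XS m N := fun k a b => ⟨zz m N k a b, zz_mem hN k a b⟩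
  have hPP : ∀ w a b, PP m N w a (zz m N w a b) := fun w a b => .inr ⟨b, zz_Sg w a b⟩
  have hRR : ∀ w a b, RR m N w b (zz m N w a b) := fun w a b => .inr ⟨a, zz_Sg w a b⟩
  have hcov : ∀ x, ∃ i, x ∈ U i := fun x => cover x.1 x.2
  refine ⟨?_, ?_⟩
  · have J : ∀ i (x y : XS m N), x ∈ U i → y ∈ U i → Joined x y := by
      intro i x y hx hy
      obtain ⟨γ⟩ := PathConnectedSpace.joined (⟨x, hx⟩ : U i) ⟨y, hy⟩
      exact ⟨γ.map continuous_subtype_val⟩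
    have J2 : ∀ x : XS m N, Joined (c 1) x := by
      intro x
      obtain ⟨(e | k), hx⟩ := hcov x
      · exact J _ _ _ (cc_O 1 e) hx
      · exact (J (.inl false) (c 1) (z k false false) (cc_O (N := N) 1 false) (zz_O0 k false false)).trans
          (J (.inr k) _ _ (zz_Ok k false false) hx)
    have : Nonempty (XS m N) := ⟨c 1⟩
    exact ⟨this, fun x y => (J2 x).symm.trans (J2 y)⟩
  · refine pi_eq U (fun i => (open_OO i).preimage continuous_subtype_val) hcov c
      (fun g e => cc_O g e) z ?_ ?_ ?_ ?_ ?_ ?_ ?_ (fun i p => sig m N i p) ?_ ?_ ?_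
    · rintro p ⟨h0, h1⟩
      rcases low_bas hN p.2 h0.1 with h | h | ⟨g, h⟩
      · exact absurd h h1.2.ne'
      · exact absurd h h0.2.ne
      · exact ⟨g, joined_sub2 _ _ (tube_join hm hN ⟨p.2, h0, h1⟩ h.2.1 h.2.2)⟩
    · intro w a b
      have := Sg_tube hN (zz_mem hN w a b).1 (zz_Sg (m := m) w a b)
      exact joined_sub2 _ _ (tube_join hm hN ⟨zz_mem hN w a b, zz_O0 _ _ _, zz_O1 _ _ _⟩ this.2.1 this.2.2)
    · intro w a b
      exact joined_sub2 _ _ ((PP_join hN ⟨zz_mem hN w a false, zz_O0 _ _ _, zz_Ok _ _ _⟩ (hPP _ _ _)).trans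
        (PP_join hN ⟨zz_mem hN w a b, zz_O0 _ _ _, zz_Ok _ _ _⟩ (hPP _ _ _)).symm)
    · intro w a b
      exact joined_sub2 _ _ ((RR_join hN ⟨zz_mem hN w false b, zz_O1 _ _ _, zz_Ok _ _ _⟩ (hRR _ _ _)).trans
        (RR_join hN ⟨zz_mem hN w a b, zz_O1 _ _ _, zz_Ok _ _ _⟩ (hRR _ _ _)).symm)
    · rintro w p ⟨h0, hk⟩
      obtain ⟨a, ha⟩ := ex_PP hNi p.2 h0 hk
      exact ⟨a, joined_sub2 _ _ ((PP_join hN ⟨p.2, h0, hk⟩ ha).trans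
        (PP_join hN ⟨zz_mem hN w a false, zz_O0 _ _ _, zz_Ok _ _ _⟩ (hPP _ _ _)).symm)⟩
    · rintro w p ⟨h0, hk⟩
      obtain ⟨a, ha⟩ := ex_RR hNi p.2 h0 hk
      exact ⟨a, joined_sub2 _ _ ((RR_join hN ⟨p.2, h0, hk⟩ ha).trans
        (RR_join hN ⟨zz_mem hN w false a, zz_O1 _ _ _, zz_Ok _ _ _⟩ (hRR _ _ _)).symm)⟩
    · intro w w' p h h'
      exact N_unique hNi h.2.1 h.2.2 h'.2.1 h'.2.2
    · intro p; rfl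
    · intro g
      show sig m N (.inl true) (cc m g) = g
      rw [sig, if_pos (cc_O (N := N) g false).2]
      exact tl_eq hm (y := 4 * (m g : ℝ)) le_rfl (by linarith)
    · rintro i j x ⟨hi, hj⟩
      have := (continuous_subtype_val.tendsto x).eventually (sig_loc hm hNi hN i j x.1 x.2 hi hj)
      filter_upwards [this] with y hy h
      exact hy y.2 h.1 h.2
end Geo
end PiOne

namespace PiOne

open Set Topology unitInterval

theorem loc_I : LocallyConnectedSpace I := by
  have := (isQuotientMap_projIcc (a := (0:ℝ)) (b := 1) (h := zero_le_one))
  exact this.isCoinducing.locallyConnectedSpace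

/-- Embedding. -/
noncomputable def psi (p : ℝ × ℝ × ℝ × ℝ) : Fin 4 → ℝ :=
  ![1 / (1 + p.1), p.2.1 + 3 * Real.sin p.1, p.2.2.1 / (1 + p.1), p.2.2.2]

/-- Its inverse. -/
noncomputable def chi (q : Fin 4 → ℝ) : ℝ × ℝ × ℝ × ℝ :=
  (1 / q 0 - 1, q 1 - 3 * Real.sin (1 / q 0 - 1), q 2 / q 0, q 3)

theorem chi_psi {p : ℝ × ℝ × ℝ × ℝ} (h : 0 ≤ p.1) : chi (psi p) = p := by
  obtain ⟨t, x, y, w⟩ := p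
  simp only at h
  have h1 : (1 + t) ≠ 0 := by positivity
  have h2 : 1 / (1 / (1 + t)) - 1 = t := by field_simp; ring
  simp only [chi, psi, Matrix.cons_val, h2, Prod.mk.injEq, true_and, and_true]
  refine ⟨by ring, ?_⟩
  field_simp

theorem psi_chi {q : Fin 4 → ℝ} (h : 0 < q 0) : psi (chi q) = q := by
  have h2 : 1 + (1 / q 0 - 1) = 1 / q 0 := by ring
  ext i
  fin_cases i <;> simp [chi, psi, h.ne']

theorem chi_cont : ContinuousOn chi {q | 0 < q 0} := by
  have h : ContinuousOn (fun q : Fin 4 → ℝ => 1 / q 0) {q | 0 < q 0} := by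
    apply ContinuousOn.div continuousOn_const (by fun_prop)
    intro x hx; exact ne_of_gt hx
  have h2 : ContinuousOn (fun q : Fin 4 → ℝ => q 2 / q 0) {q | 0 < q 0} := by
    apply ContinuousOn.div (by fun_prop) (by fun_prop)
    intro x hx; exact ne_of_gt hx
  unfold chi
  have h3 := Real.continuous_sin.comp_continuousOn (h.sub (continuousOn_const (c := (1:ℝ))))
  refine (h.sub continuousOn_const).prodMk (ContinuousOn.prodMk ?_ (h2.prodMk (by fun_prop)))
  exact ContinuousOn.sub (by fun_prop) (continuousOn_const.mul h3)

variable (S : Set (ℝ × ℝ × ℝ × ℝ))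

/-- Image of the embedding. -/
def X' : Set (Fin 4 → ℝ) := {q | 0 < q 0 ∧ chi q ∈ S}
/-- The limit box. -/
def LL : Set (Fin 4 → ℝ) := {q | q 0 = 0 ∧ -4 ≤ q 1 ∧ q 1 ≤ 4 ∧ 0 ≤ q 2 ∧ q 2 ≤ 4 ∧ -1 ≤ q 3 ∧ q 3 ≤ 1}
/-- The segment. -/
def Sgm : Set (Fin 4 → ℝ) := {q | 0 ≤ q 0 ∧ q 0 ≤ 1 ∧ q 1 = 0 ∧ q 2 = 0 ∧ q 3 = q 0 - 1}
/-- The second piece. -/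
def MM : Set (Fin 4 → ℝ) := LL ∪ Sgm
/-- The compactum. -/
def KK : Set (Fin 4 → ℝ) := X' S ∪ MM

/-- The base point. -/
def b1 : Fin 4 → ℝ := ![1, 0, 0, 0]

variable {S}

theorem X'_bd (hB : ∀ p ∈ S, Box p) {q : Fin 4 → ℝ} (hq : q ∈ X' S) :
    q 0 ≤ 1 ∧ 3 * Real.sin (1 / q 0 - 1) ≤ q 1 ∧ q 1 ≤ 3 * Real.sin (1 / q 0 - 1) + 1 ∧
    0 ≤ q 2 ∧ q 2 ≤ 4 ∧ 0 ≤ q 3 ∧ q 3 ≤ 1 := by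
  obtain ⟨h0, h1⟩ := hq
  obtain ⟨a, b, c, d, e, f, g⟩ := hB _ h1
  simp only [chi] at a b c d e f g
  have a' : 1 ≤ 1 / q 0 := by linarith
  rw [le_div_iff₀ h0] at a'
  have d' : 0 ≤ q 2 := by
    have := mul_nonneg d h0.le
    rwa [div_mul_cancel₀ _ h0.ne'] at this
  have e' : q 2 ≤ 4 := by
    rw [div_le_iff₀ h0] at e
    have : (4 * (1 / q 0 - 1) + 4) * q 0 = 4 := by field_simp; ring
    linarith
  exact ⟨by linarith, by linarith, by linarith, d', e', f, g⟩

theorem X'_M (hB : ∀ p ∈ S, Box p) {q : Fin 4 → ℝ} (hq : q ∈ X' S) (hM : q ∈ MM) : q = b1 := by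
  have h := X'_bd hB hq
  have h0 := hq.1
  rcases hM with hM | hM
  · exact absurd hM.1 h0.ne'
  · obtain ⟨a, b, c, d, e⟩ := hM
    have : q 0 = 1 := by linarith [h.2.2.2.2.2.1]
    ext i
    fin_cases i <;> simp [b1, *]

theorem closed_LL : IsClosed LL := by
  unfold LL
  simp only [ofPred_and]
  refine IsClosed.inter (isClosed_eq (by fun_prop) (by fun_prop)) ?_
  repeat' apply IsClosed.inter
  all_goals exact isClosed_le (by fun_prop) (by fun_prop)

theorem closed_Sgm : IsClosed Sgm := by
  unfold Sgm
  simp only [ofPred_and]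
  repeat' apply IsClosed.inter
  all_goals first | exact isClosed_le (by fun_prop) (by fun_prop) | exact isClosed_eq (by fun_prop) (by fun_prop)

theorem closed_MM : IsClosed MM := closed_LL.union closed_Sgm

theorem KK_sub (hB : ∀ p ∈ S, Box p) : KK S ⊆ Icc ![0, -4, 0, -1] ![1, 4, 4, 1] := by
  have key : ∀ q : Fin 4 → ℝ, 0 ≤ q 0 → q 0 ≤ 1 → -4 ≤ q 1 → q 1 ≤ 4 → 0 ≤ q 2 → q 2 ≤ 4 → -1 ≤ q 3 → 
      q 3 ≤ 1 → q ∈ Icc (![0, -4, 0, -1] : Fin 4 → ℝ) ![1, 4, 4, 1] := by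
    intro q h1 h2 h3 h4 h5 h6 h7 h8
    constructor <;> intro i <;> fin_cases i <;> simpa
  rintro q (hq | hq | hq)
  · obtain ⟨a, b, c, d, e, f, g⟩ := X'_bd hB hq
    have h1 := Real.neg_one_le_sin (1 / q 0 - 1)
    have h2 := Real.sin_le_one (1 / q 0 - 1)
    exact key q hq.1.le a (by linarith) (by linarith) d e (by linarith) g
  · obtain ⟨a, b, c, d, e, f, g⟩ := hq
    apply key q <;> linarith
  · obtain ⟨a, b, c, d, e⟩ := hq
    apply key q <;> linarith

theorem closed_XL (hS : IsClosed S) (hB : ∀ p ∈ S, Box p) : IsClosed (X' S ∪ LL) := by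
  rw [← isOpen_compl_iff, isOpen_iff_mem_nhds]
  intro q hq
  by_cases h0 : 0 < q 0
  · have hc : ContinuousAt chi q := chi_cont.continuousAt ((isOpen_lt continuous_const (by fun_prop)).mem_nhds h0)
    have : chi q ∈ Sᶜ := fun h => hq (.inl ⟨h0, h⟩)
    have h3 := hc.preimage_mem_nhds (hS.isOpen_compl.mem_nhds this)
    have h4 : {p : Fin 4 → ℝ | 0 < p 0} ∈ 𝓝 q := (isOpen_lt continuous_const (by fun_prop)).mem_nhds h0
    filter_upwards [h3, h4] with p hp hp0 
    rintro (h | h)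
    · exact hp h.2
    · exact hp0.ne' h.1
  · have hR : q ∉ Icc (![0, -4, 0, -1] : Fin 4 → ℝ) ![1, 4, 4, 1] := by
      rintro ⟨h1, h2⟩
      apply hq
      right
      have a0 := h1 0; have a1 := h1 1; have a2 := h1 2; have a3 := h1 3
      have c0 := h2 0; have c1 := h2 1; have c2 := h2 2; have c3 := h2 3
      simp at a0 a1 a2 a3 c0 c1 c2 c3
      exact ⟨le_antisymm (not_lt.1 h0) a0, a1, c1, a2, c2, a3, c3⟩
    filter_upwards [isClosed_Icc.isOpen_compl.mem_nhds hR] with p hp hp'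
    apply hp
    apply KK_sub hB
    rcases hp' with h | h
    · exact .inl h
    · exact .inr (.inl h)

theorem compact_KK (hS : IsClosed S) (hB : ∀ p ∈ S, Box p) : IsCompact (KK S) := by
  have : KK S = (X' S ∪ LL) ∪ Sgm := by simp only [KK, MM, union_assoc]
  have hc : IsClosed (KK S) := this ▸ (closed_XL hS hB).union closed_Sgm
  exact isCompact_Icc.of_isClosed_subset hc (KK_sub hB)

theorem key_closed (hS : IsClosed S) (hB : ∀ p ∈ S, Box p) {Z : Type*} [TopologicalSpace Z]
    [LocallyConnectedSpace Z] {g : Z → Fin 4 → ℝ} (hg : Continuous g) (hK : ∀ z, g z ∈ KK S) :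
    IsClosed (g ⁻¹' X' S) := by
  rw [← isOpen_compl_iff, isOpen_iff_mem_nhds]
  intro z hz
  by_cases hL : g z ∈ LL
  swap
  · have : g z ∈ (X' S ∪ LL)ᶜ := by rintro (h | h); exacts [hz h, hL h]
    filter_upwards [hg.continuousAt.preimage_mem_nhds ((closed_XL hS hB).isOpen_compl.mem_nhds this)] with y hy h
    exact hy (.inl h)
  have hBo : IsOpen {p : Fin 4 → ℝ | p 0 < 1 ∧ |p 1 - g z 1| < 1/2} := by
    simp only [Set.ofPred_and]
    exact (isOpen_lt (by fun_prop) (by fun_prop)).inter (isOpen_lt (by fun_prop) (by fun_prop))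
  obtain ⟨W, hWB, hWo, hzW, hWc⟩ := locallyConnectedSpace_iff_subsets_isOpen_isConnected.1 ‹_› z _
    (hg.continuousAt.preimage_mem_nhds (hBo.mem_nhds (show g z ∈ _ from ⟨by rw [hL.1]; norm_num, by simp⟩)))
  filter_upwards [hWo.mem_nhds hzW] with z' hz' hX
  obtain ⟨s, hs0, hs1, hsl⟩ : ∃ s : ℝ, 0 < s ∧ s < g z' 0 ∧ ∀ p ∈ X' S, p 0 = s → ¬ |p 1 - g z 1| < 1/2 := by
    obtain ⟨n, hn⟩ := exists_nat_gt (1 / g z' 0)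
    have hpos := hX.1
    have hn0 : (0:ℝ) ≤ n := by positivity
    have hp := Real.pi_gt_three
    rw [div_lt_iff₀ hpos] at hn
    rcases le_total (g z 1) 0 with h | h
    · refine ⟨1 / (1 + (Real.pi / 2 + n * (2 * Real.pi))), by positivity, ?_, ?_⟩
      · rw [div_lt_iff₀ (by positivity)]
        nlinarith [mul_nonneg hn0 hpos.le, mul_pos hpos Real.pi_pos]
      · intro p hp h0 h1
        have := X'_bd hB hp
        rw [h0, one_div_one_div, add_sub_cancel_left, Real.sin_add_nat_mul_two_pi, Real.sin_pi_div_two] at this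
        linarith [abs_lt.1 h1]
    · refine ⟨1 / (1 + (-(Real.pi / 2) + (n + 1 : ℕ) * (2 * Real.pi))), ?_, ?_, ?_⟩
      · push_cast
        have := mul_nonneg hn0 Real.pi_pos.le
        apply one_div_pos.2; nlinarith
      · push_cast
        have := mul_nonneg hn0 Real.pi_pos.le
        rw [div_lt_iff₀ (by nlinarith)]
        nlinarith [mul_nonneg hn0 hpos.le, mul_pos hpos Real.pi_pos, mul_nonneg (mul_nonneg hn0 hpos.le) (sub_nonneg.2 hp.le)]
      · intro p hp h0 h1
        have := X'_bd hB hp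
        rw [h0, one_div_one_div, add_sub_cancel_left, Real.sin_add_nat_mul_two_pi, Real.sin_neg, Real.sin_pi_div_two] at this
        linarith [abs_lt.1 h1]
  have huo : IsOpen (g ⁻¹' ({p | s < p 0} ∩ MMᶜ)) :=
    ((isOpen_lt (by fun_prop) (by fun_prop)).inter closed_MM.isOpen_compl).preimage hg
  have hvo : IsOpen (g ⁻¹' ({p | s ≤ p 0} ∩ (X' S ∪ LL))ᶜ) :=
    (((isClosed_le (by fun_prop) (by fun_prop)).inter (closed_XL hS hB)).isOpen_compl).preimage hg
  have hnM : ∀ y ∈ W, g y ∈ X' S → g y ∉ MM := by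
    intro y hy h1 h2
    have := X'_M hB h1 h2
    have h3 := (hWB hy).1
    rw [this] at h3
    simp [b1] at h3
  have hcov : W ⊆ g ⁻¹' ({p | s < p 0} ∩ MMᶜ) ∪ g ⁻¹' ({p | s ≤ p 0} ∩ (X' S ∪ LL))ᶜ := by
    intro y hy
    by_cases h : g y ∈ ({p | s ≤ p 0} ∩ (X' S ∪ LL))
    swap
    · exact .inr h
    left
    obtain ⟨h1, h2 | h2⟩ := h
    · refine ⟨lt_of_le_of_ne h1 fun h => hsl _ h2 h.symm (hWB hy).2, hnM y hy h2⟩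
    · simp only [mem_ofPred_eq] at h1
      linarith [h2.1]
  obtain ⟨y, hyW, hyu, hyv⟩ := hWc.isPreconnected _ _ huo hvo hcov ⟨z', hz', hs1, hnM z' hz' hX⟩
    ⟨z, hzW, fun h => by have := h.1; simp only [mem_ofPred_eq, hL.1] at this; linarith⟩
  apply hyv
  have h5 : s < g y 0 := hyu.1
  exact ⟨show s ≤ g y 0 from h5.le, .inl ((hK y).resolve_right hyu.2)⟩

open Classical in
theorem glue (hS : IsClosed S) (hB : ∀ p ∈ S, Box p) {Z Y : Type*} [TopologicalSpace Z] [TopologicalSpace Y]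
    [LocallyConnectedSpace Z] {g : Z → Fin 4 → ℝ} (hg : Continuous g) (hK : ∀ z, g z ∈ KK S)
    {a b : Z → Y} (ha : ContinuousOn a (g ⁻¹' X' S)) (hb : ContinuousOn b (g ⁻¹' MM))
    (hab : ∀ z, g z = b1 → a z = b z) : Continuous fun z => if g z ∈ X' S then a z else b z := by
  rw [← continuousOn_univ]
  have : (univ : Set Z) = g ⁻¹' X' S ∪ g ⁻¹' MM := by
    ext z; simpa [KK] using hK z
  rw [this]
  apply ContinuousOn.union_of_isClosed _ _ (key_closed hS hB hg hK) (closed_MM.preimage hg)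
  · exact ha.congr fun z hz => if_pos hz
  · refine hb.congr fun z hz => ?_
    split_ifs with h
    · exact hab z (X'_M hB h hz)
    · rfl
end PiOne

namespace PiOne

open Set Topology unitInterval

theorem transfer {X Y : Type*} [TopologicalSpace X] [TopologicalSpace Y] (i : C(X, Y)) (r : Y → X)
    (h1 : ∀ f : I → Y, Continuous f → Continuous (r ∘ f))
    (h2 : ∀ f : I × I → Y, Continuous f → Continuous (r ∘ f))
    (hr : ∀ x, r (i x) = x) (b : X)
    (h3 : ∀ f : Path (i b) (i b), ∃ H : C(I × I, Y), (∀ s, H (0, s) = f s) ∧ (∀ s, H (1, s) = i (r (f s)))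
      ∧ (∀ t, H (t, 0) = i b) ∧ ∀ t, H (t, 1) = i b) :
    Function.Bijective (FundamentalGroup.map i b) := by
  constructor
  · intro p q hpq
    induction p using Path.Homotopic.Quotient.ind with | mk p =>
    induction q using Path.Homotopic.Quotient.ind with | mk q =>
    have hpq' : Path.Homotopic.Quotient.mk (p.map i.continuous) = Path.Homotopic.Quotient.mk (q.map i.continuous) := hpq
    obtain ⟨H⟩ := Path.Homotopic.Quotient.exact hpq'
    refine Path.Homotopic.Quotient.eq.2 ⟨⟨⟨⟨r ∘ H, h2 _ H.continuous⟩, ?_, ?_⟩, ?_⟩⟩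
    · intro x; simp [hr]
    · intro x; simp [hr]
    · intro t x hx
      have := H.prop' t x hx
      change r (H (t, x)) = p x
      have h' : H (t, x) = i (p x) := this
      rw [h', hr]
  · intro f
    induction f using Path.Homotopic.Quotient.ind with | mk f =>
    obtain ⟨H, a, c, d, e⟩ := h3 f
    let P : Path b b := ⟨⟨r ∘ f, h1 _ f.continuous⟩, by simp [hr], by simp [hr]⟩
    refine ⟨Path.Homotopic.Quotient.mk P, ?_⟩
    change Path.Homotopic.Quotient.mk (P.map i.continuous) = _
    refine (Path.Homotopic.Quotient.eq.2 ⟨⟨⟨H, ?_, ?_⟩, ?_⟩⟩).symm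
    · intro s; exact a s
    · intro s; exact c s
    · rintro t x (rfl | rfl)
      · exact (d t).trans f.source.symm
      · exact (e t).trans f.target.symm

variable {S : Set (ℝ × ℝ × ℝ × ℝ)}

/-- The collapse. -/
def rho (q : Fin 4 → ℝ) : Fin 4 → ℝ := ![q 0, 0, 0, q 0 - 1]

theorem rho_cont : Continuous rho := by
  refine continuous_pi fun i => ?_
  fin_cases i <;> simp [rho] <;> fun_prop

theorem rho_Sgm {q : Fin 4 → ℝ} (h : q ∈ Sgm) : rho q = q := by
  obtain ⟨a, b, c, d, e⟩ := h
  ext i; fin_cases i <;> simp [rho, *]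

theorem rho_mem {q : Fin 4 → ℝ} (h : q ∈ MM) : rho q ∈ Sgm := by
  rcases h with h | h
  · simp [rho, Sgm, h.1]
  · rwa [rho_Sgm h]

theorem convex_LL : Convex ℝ LL := by
  intro p hp q hq a b ha hb hab
  obtain ⟨a0, a1, a2, a3, a4, a5, a6⟩ := hp
  obtain ⟨c0, c1, c2, c3, c4, c5, c6⟩ := hq
  obtain rfl : b = 1 - a := by linarith
  refine ⟨?_, ?_, ?_, ?_, ?_, ?_, ?_⟩ <;> simp only [Pi.add_apply, Pi.smul_apply, smul_eq_mul] <;>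
  first | (rw [a0, c0]; ring) | nlinarith

theorem convex_Sgm : Convex ℝ Sgm := by
  intro p hp q hq a b ha hb hab
  obtain ⟨a0, a1, a2, a3, a4⟩ := hp
  obtain ⟨c0, c1, c2, c3, c4⟩ := hq
  obtain rfl : b = 1 - a := by linarith
  refine ⟨?_, ?_, ?_, ?_, ?_⟩ <;> simp only [Pi.add_apply, Pi.smul_apply, smul_eq_mul] <;>
  first | (simp only [a2, c2, a3, c3, a4, c4]; ring) | nlinarith

theorem b1_Sgm : b1 ∈ Sgm := by simp [Sgm, b1]

theorem psi_zero : psi (0, 0, 0, 0) = b1 := by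
  ext i; fin_cases i <;> simp [psi, b1]

theorem chi_b1 : chi b1 = (0, 0, 0, 0) := by
  rw [← psi_zero, chi_psi le_rfl]

theorem b1_X' (h0 : (0, 0, 0, 0) ∈ S) : b1 ∈ X' S := ⟨by simp [b1], by rwa [chi_b1]⟩

theorem psi_mem (hB : ∀ p ∈ S, Box p) {p} (hp : p ∈ S) : psi p ∈ X' S := by
  have h := (hB p hp).1
  refine ⟨?_, by rwa [chi_psi h]⟩
  simp only [psi, Matrix.cons_val]; positivity

theorem psi_cont : ContinuousOn psi {p | 0 ≤ p.1} := by
  have h : ContinuousOn (fun p : ℝ × ℝ × ℝ × ℝ => 1 / (1 + p.1)) {p | 0 ≤ p.1} :=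
    ContinuousOn.div continuousOn_const (by fun_prop) fun x (hx : 0 ≤ x.1) => by positivity
  have h2 : ContinuousOn (fun p : ℝ × ℝ × ℝ × ℝ => p.2.2.1 / (1 + p.1)) {p | 0 ≤ p.1} :=
    ContinuousOn.div (by fun_prop) (by fun_prop) fun x (hx : 0 ≤ x.1) => by positivity
  refine continuousOn_pi.2 fun i => ?_
  fin_cases i
  · exact h
  · simp only [psi]; simp; fun_prop
  · exact h2
  · simp only [psi]; simp; fun_prop

/-- Inclusion. -/
noncomputable def inc (hB : ∀ p ∈ S, Box p) : C(S, KK S) :=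
  ⟨fun p => ⟨psi p.1, .inl (psi_mem hB p.2)⟩, by
    refine Continuous.subtype_mk ?_ _
    exact psi_cont.comp_continuous continuous_subtype_val fun p => (hB p.1 p.2).1⟩

open Classical in
/-- Retraction. -/
noncomputable def ret (h0 : (0, 0, 0, 0) ∈ S) (q : KK S) : S :=
  if h : q.1 ∈ X' S then ⟨chi q.1, h.2⟩ else ⟨_, h0⟩

open Classical in
theorem ret_val (h0 : (0, 0, 0, 0) ∈ S) (q : KK S) : (ret h0 q).1 = 
    if q.1 ∈ X' S then chi q.1 else (0, 0, 0, 0) := by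
  unfold ret; split_ifs <;> rfl

theorem ret_cont (hS : IsClosed S) (hB : ∀ p ∈ S, Box p) (h0 : (0, 0, 0, 0) ∈ S) {Z : Type*} [TopologicalSpace Z]
    [LocallyConnectedSpace Z] {g : Z → KK S} (hg : Continuous g) : Continuous (ret h0 ∘ g) := by
  rw [continuous_induced_rng]
  have := glue hS hB (g := fun z => (g z).1) (by fun_prop) (fun z => (g z).2)
    (a := fun z => chi (g z).1) (b := fun z => (0, 0, 0, 0))
    (chi_cont.comp (by fun_prop) fun z hz => hz.1) continuousOn_const (fun z hz => by simp only [hz, chi_b1])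
  exact this.congr fun z => (ret_val h0 (g z)).symm

theorem ret_inc (hB : ∀ p ∈ S, Box p) (h0 : (0, 0, 0, 0) ∈ S) (x : S) : ret h0 (inc hB x) = x := by
  ext1
  rw [ret_val, if_pos (show (inc hB x).1 ∈ X' S from psi_mem hB x.2)]
  exact chi_psi (hB _ x.2).1

theorem inc_zero (hB : ∀ p ∈ S, Box p) (h0 : (0, 0, 0, 0) ∈ S) : (inc hB ⟨_, h0⟩).1 = b1 := psi_zero

theorem pi_KK (hS : IsClosed S) (hB : ∀ p ∈ S, Box p) (h0 : (0, 0, 0, 0) ∈ S) :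
    Function.Bijective (FundamentalGroup.map (inc hB) ⟨_, h0⟩) := by
  classical
  haveI := loc_I
  refine transfer (inc hB) (ret h0) (fun f hf => ret_cont hS hB h0 hf) (fun f hf => ret_cont hS hB h0 hf)
    (ret_inc hB h0) _ ?_
  intro f
  have hfm : ∀ s, (f s).1 ∉ X' S → (f s).1 ∈ MM := fun s h => (f s).2.resolve_left h
  have hfc : Continuous fun z : I × I => (f z.2).1 := by fun_prop
  -- combined homotopy
  let c1 : I → ℝ := fun t => min 1 (2 * t)
  let c2 : I → ℝ := fun t => max 0 (2 * t - 1)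
  let B : I × I → Fin 4 → ℝ := fun z => (1 - c2 z.1) • ((1 - c1 z.1) • (f z.2).1 + c1 z.1 • rho (f z.2).1) + c2 z.1 • b1
  have hBc : Continuous B := by
    have := rho_cont
    simp only [B, c1, c2]; fun_prop
  have hb1 : ∀ z : I × I, (f z.2).1 = b1 → (f z.2).1 = B z := by
    intro z hz
    simp only [B, hz, rho_Sgm b1_Sgm]
    module
  have hBM : ∀ z : I × I, (f z.2).1 ∈ MM → B z ∈ MM := by
    intro z hz
    have hz0 := z.1.2.1
    have hz1 := z.1.2.2
    have a0 : 0 ≤ c1 z.1 := by simp only [c1]; exact le_min (by norm_num) (by linarith)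
    have a1 : c1 z.1 ≤ 1 := min_le_left _ _
    have a2 : 0 ≤ c2 z.1 := le_max_left _ _
    have a3 : c2 z.1 ≤ 1 := max_le (by norm_num) (by linarith)
    have hr := rho_mem hz
    rcases le_total (2 * (z.1 : ℝ)) 1 with h | h
    · have : c2 z.1 = 0 := max_eq_left (by linarith)
      simp only [B, this, sub_zero, one_smul, zero_smul, add_zero]
      rcases hz with hz | hz
      · left
        refine convex_LL hz ?_ (by linarith) a0 (by ring)
        simp [LL, rho, hz.1]
      · right
        exact convex_Sgm hz hr (by linarith) a0 (by ring)
    · have : c1 z.1 = 1 := min_eq_left h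
      simp only [B, this, sub_self, one_smul, zero_smul, zero_add]
      exact .inr (convex_Sgm hr b1_Sgm (by linarith) a2 (by ring))
  have hG := glue hS hB hfc (fun z => (f z.2).2) (a := fun z => (f z.2).1) (b := B) hfc.continuousOn
    hBc.continuousOn hb1
  have hmem : ∀ z : I × I, (if (f z.2).1 ∈ X' S then (f z.2).1 else B z) ∈ KK S := by
    intro z
    split_ifs with h
    · exact (f z.2).2
    · exact .inr (hBM z (hfm _ h))
  refine ⟨⟨fun z => ⟨_, hmem z⟩, hG.subtype_mk _⟩, ?_, ?_, ?_, ?_⟩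
  · intro s
    ext1
    change (if (f s).1 ∈ X' S then (f s).1 else B (0, s)) = (f s).1
    split_ifs with h
    · rfl
    · simp [B, c1, c2]
  · intro s
    ext1
    change (if (f s).1 ∈ X' S then (f s).1 else B (1, s)) = psi (ret h0 (f s)).1
    rw [ret_val]
    split_ifs with h
    · exact (psi_chi h.1).symm
    · rw [psi_zero]
      have e1 : c1 1 = 1 := by simp [c1]
      have e2 : c2 1 = 1 := by simp only [c2]; norm_num
      simp [B, e1, e2]
  · intro t
    ext1
    change (if (f 0).1 ∈ X' S then (f 0).1 else B (t, 0)) = _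
    rw [f.source, if_pos]
    exact psi_mem hB h0
  · intro t
    ext1
    change (if (f 1).1 ∈ X' S then (f 1).1 else B (t, 1)) = _
    rw [f.target, if_pos]
    exact psi_mem hB h0

theorem pc_KK (hB : ∀ p ∈ S, Box p) (h0 : (0, 0, 0, 0) ∈ S) [PathConnectedSpace S] : IsPathConnected (KK S) := by
  have h1 : IsPathConnected (X' S) := by
    have : X' S = range (fun p : S => psi p.1) := by
      ext q; constructor
      · intro h; exact ⟨⟨_, h.2⟩, psi_chi h.1⟩
      · rintro ⟨p, rfl⟩; exact psi_mem hB p.2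
    rw [this]
    exact isPathConnected_range (psi_cont.comp_continuous continuous_subtype_val fun p => (hB p.1 p.2).1)
  have hl : (![0, 0, 0, -1] : Fin 4 → ℝ) ∈ LL := by simp [LL]
  have hl' : (![0, 0, 0, -1] : Fin 4 → ℝ) ∈ Sgm := by simp [Sgm]
  have h2 : IsPathConnected MM := (convex_LL.isPathConnected ⟨_, hl⟩).union (convex_Sgm.isPathConnected ⟨_, hl'⟩) ⟨_, hl, hl'⟩
  exact h1.union h2 ⟨b1, b1_X' h0, .inr b1_Sgm⟩

theorem final (G : Type) [Group G] [Countable G] :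
    ∃ K : Set (Fin 4 → ℝ), IsCompact K ∧ IsPathConnected K ∧ ∀ x : ↥K, Nonempty (FundamentalGroup ↥K x ≃* G) := by
  obtain ⟨m, hm⟩ := exists_injective_nat G
  let N : G × G → ℕ := fun k => Nat.pair (Nat.pair (m k.1) (m k.2)) (m (k.1 * k.2) + m 1)
  have hNi : Function.Injective N := by
    rintro ⟨g, h⟩ ⟨g', h'⟩ e
    simp only [N, Nat.pair_eq_pair] at e
    rw [hm e.1.1, hm e.1.2]
  have hN : ∀ k a b, m (kap k.1 k.2 a b) ≤ N k := by
    rintro ⟨g, h⟩ a b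
    have e1 := Nat.left_le_pair (Nat.pair (m g) (m h)) (m (g * h) + m 1)
    have e2 := Nat.right_le_pair (Nat.pair (m g) (m h)) (m (g * h) + m 1)
    have e3 := Nat.left_le_pair (m g) (m h)
    have e4 := Nat.right_le_pair (m g) (m h)
    cases a <;> cases b <;> simp [kap, N] <;> omega
  obtain ⟨hp, ⟨e⟩⟩ := XS_pi hm hNi hN
  have hB : ∀ p ∈ XS m N, Box p := fun p hp => hp.1
  have h0 : (0, 0, 0, 0) ∈ XS m N := by
    refine ⟨?_, .inl ⟨rfl, .inl rfl⟩⟩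
    norm_num [Box]
  have hS := closed_XS hm hNi
  have hpc := pc_KK hB h0
  refine ⟨KK (XS m N), compact_KK hS hB, hpc, fun x => ?_⟩
  haveI := isPathConnected_iff_pathConnectedSpace.1 hpc
  exact ⟨(FundamentalGroup.fundamentalGroupMulEquivOfPathConnected x _).trans
    ((MulEquiv.ofBijective _ (pi_KK hS hB h0)).symm.trans
      ((FundamentalGroup.fundamentalGroupMulEquivOfPathConnected _ _).trans e))⟩
end PiOne

/-- Every countable group is the fundamental group of some compact path connected subspace
of `ℝ⁴` (at any basepoint; the space is path connected so the choice is immaterial). -/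
theorem countable_group_is_pi1_of_compact_subset_R4
    (G : Type) [Group G] [Countable G] :
    ∃ K : Set (Fin 4 → ℝ), IsCompact K ∧ IsPathConnected K ∧
      ∀ x : ↥K, Nonempty (FundamentalGroup ↥K x ≃* G) := 
  PiOne.final G
end
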